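/- arXiv:0801.2291 — 2 statements merged into one kernel-verified Lean document; each statement's English description precedes it below -/
import Mathlib

section
/- Let u be a bounded solution of Pu = f on ℝ^N × ℝ, where the operator P and the function f are periodic in the m-th variable (m ∈ {1,…,N+1}) with the same period l_m, and the zero-order coefficient satisfies c ≤ 0. Then u is periodic in the m-th variable with period l_m, i.e. u(X + l_m e_m) = u(X) for all X ∈ ℝ^{N+1}. -/
open Filter Topology

noncomputable section

/-- First-order spatial partial derivative in the direction `i`. -/
def pd {N : ℕ} (i : Fin N) (φ : (Fin N → ℝ) → ℝ) (x : Fin N → ℝ) : ℝ :=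
  fderiv ℝ φ x (Pi.single i 1)

/-- Second-order spatial partial derivative `∂ᵢⱼ`. -/
def pd2 {N : ℕ} (i j : Fin N) (φ : (Fin N → ℝ) → ℝ) (x : Fin N → ℝ) : ℝ :=
  pd i (fun y => pd j φ y) x

/-- The parabolic operator `P u = ∂ₜ u − aᵢⱼ ∂ᵢⱼ u − bᵢ ∂ᵢ u − c u`. -/
def parOp {N : ℕ} (a : Fin N → Fin N → (Fin N → ℝ) → ℝ → ℝ)
    (b : Fin N → (Fin N → ℝ) → ℝ → ℝ) (c : (Fin N → ℝ) → ℝ → ℝ)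
    (u : (Fin N → ℝ) → ℝ → ℝ) (x : Fin N → ℝ) (t : ℝ) : ℝ :=
  deriv (fun s => u x s) t
    - (∑ i, ∑ j, a i j x t * pd2 i j (fun y => u y t) x)
    - (∑ i, b i x t * pd i (fun y => u y t) x)
    - c x t * u x t

/-- A bounded function on `ℝ^N × ℝ`. -/
def Bdd2 {N : ℕ} (φ : (Fin N → ℝ) → ℝ → ℝ) : Prop :=
  ∃ M : ℝ, ∀ x t, |φ x t| ≤ M

/-- A uniformly continuous function on `ℝ^N × ℝ`. -/
def UC2 {N : ℕ} (φ : (Fin N → ℝ) → ℝ → ℝ) : Prop :=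
  UniformContinuous fun p : (Fin N → ℝ) × ℝ => φ p.1 p.2

/-- Standing assumptions on the coefficients of `P`: `a`, `b` bounded and uniformly
continuous, `c` bounded and measurable, `(aᵢⱼ)` symmetric and uniformly elliptic. -/
def StdCoeffs {N : ℕ} (a : Fin N → Fin N → (Fin N → ℝ) → ℝ → ℝ)
    (b : Fin N → (Fin N → ℝ) → ℝ → ℝ) (c : (Fin N → ℝ) → ℝ → ℝ) : Prop :=
  (∀ i j, Bdd2 (a i j)) ∧ (∀ i j, UC2 (a i j)) ∧
  (∀ i, Bdd2 (b i)) ∧ (∀ i, UC2 (b i)) ∧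
  Bdd2 c ∧ Measurable (fun p : (Fin N → ℝ) × ℝ => c p.1 p.2) ∧
  (∀ i j x t, a i j x t = a j i x t) ∧
  (∃ a₀ a₁ : ℝ, 0 < a₀ ∧ a₀ ≤ a₁ ∧ ∀ (x : Fin N → ℝ) (t : ℝ) (ξ : Fin N → ℝ),
    a₀ * ∑ i, ξ i ^ 2 ≤ ∑ i, ∑ j, a i j x t * ξ i * ξ j ∧
    ∑ i, ∑ j, a i j x t * ξ i * ξ j ≤ a₁ * ∑ i, ξ i ^ 2)

/-- Regularity required of entire solutions (classical reading of the notion of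
solution used in the paper). -/
def RegSol {N : ℕ} (u : (Fin N → ℝ) → ℝ → ℝ) : Prop :=
  Continuous (fun p : (Fin N → ℝ) × ℝ => u p.1 p.2) ∧
  (∀ x, Differentiable ℝ fun s => u x s) ∧
  (∀ t, ContDiff ℝ 2 fun y => u y t)

/-- `u` is an entire solution of `P u = f` on `ℝ^N × ℝ`. -/
def IsSol {N : ℕ} (a : Fin N → Fin N → (Fin N → ℝ) → ℝ → ℝ)
    (b : Fin N → (Fin N → ℝ) → ℝ → ℝ) (c : (Fin N → ℝ) → ℝ → ℝ)
    (f u : (Fin N → ℝ) → ℝ → ℝ) : Prop :=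
  RegSol u ∧ ∀ x t, parOp a b c u x t = f x t

/-- Periodicity, with period `l`, in the `m`-th of the `N+1` space-time variables:
if `m ≤ N` this is periodicity in the space direction `x_m`, if `m = N+1` it is
periodicity in time. -/
def PerInVar {N : ℕ} (m : Fin (N + 1)) (l : ℝ) (φ : (Fin N → ℝ) → ℝ → ℝ) : Prop :=
  if h : (m : ℕ) < N then ∀ x t, φ (x + Pi.single (⟨(m : ℕ), h⟩ : Fin N) l) t = φ x t
  else ∀ x t, φ x (t + l) = φ x t

lemma aux_second {g g' : ℝ → ℝ} {g2 : ℝ} (h1 : ∀ᶠ h in 𝓝 (0:ℝ), HasDerivAt g (g' h) h)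
    (h2 : HasDerivAt g' g2 0) (hm : IsLocalMax g 0) : g' 0 = 0 ∧ g2 ≤ 0 := by
  have h0 : g' 0 = 0 := hm.hasDerivAt_eq_zero h1.self_of_nhds
  refine ⟨h0, ?_⟩
  by_contra hlt
  push Not at hlt
  have e1 : deriv g =ᶠ[𝓝 0] g' := h1.mono fun h hh => hh.deriv
  have e2 : deriv (deriv g) 0 = g2 := by
    rw [e1.deriv_eq]; exact h2.deriv
  have hmin : IsLocalMin g 0 :=
    isLocalMin_of_deriv_deriv_pos (by rw [e2]; exact hlt) (by rw [e1.eq_of_nhds, h0])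
      h1.self_of_nhds.continuousAt
  have hc : g =ᶠ[𝓝 0] fun _ => g 0 := by
    filter_upwards [hm, hmin] with h ha hb
    exact le_antisymm ha hb
  have hc' : deriv g =ᶠ[𝓝 0] fun _ => 0 := by
    have := hc.deriv
    filter_upwards [this] with h hh
    rw [hh]; simp
  have : deriv (deriv g) 0 = 0 := by rw [hc'.deriv_eq]; simp
  linarith

lemma aux_left {g : ℝ → ℝ} {d s s1 : ℝ} (hs : s1 < s) (hd : HasDerivAt g d s)
    (hm : ∀ s', s1 < s' → s' ≤ s → g s' ≤ g s) : 0 ≤ d := by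
  have h := (hasDerivAt_iff_tendsto_slope.1 hd).mono_left
    (nhdsWithin_mono s (show Set.Iio s ⊆ {s}ᶜ from fun x hx => ne_of_lt hx))
  refine ge_of_tendsto h ?_
  filter_upwards [Ioo_mem_nhdsLT hs] with s' hs'
  rw [slope_def_field]
  exact div_nonneg_of_nonpos (by linarith [hm s' hs'.1 hs'.2.le]) (by linarith [hs'.2])

lemma aux_line1 {N : ℕ} {φ : (Fin N → ℝ) → ℝ} (hφ : Differentiable ℝ φ) (x ξ : Fin N → ℝ) (h : ℝ) :
    HasDerivAt (fun h : ℝ => φ (x + h • ξ)) (∑ i, ξ i * pd i φ (x + h • ξ)) h := by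
  have h1 : HasDerivAt (fun h : ℝ => x + h • ξ) ξ h := by
    simpa using ((hasDerivAt_id h).smul_const ξ).const_add x
  have h2 := (hφ (x + h • ξ)).hasFDerivAt.comp_hasDerivAt h h1
  refine h2.congr_deriv ?_
  unfold pd
  generalize fderiv ℝ φ (x + h • ξ) = T
  conv_lhs => rw [pi_eq_sum_univ' ξ, map_sum]
  refine Finset.sum_congr rfl fun i _ => ?_
  rw [map_smul, smul_eq_mul]

lemma aux_pd_diff {N : ℕ} {φ : (Fin N → ℝ) → ℝ} (hφ : ContDiff ℝ 2 φ) (i : Fin N) :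
    Differentiable ℝ (fun y => pd i φ y) := by
  unfold pd
  have : ContDiff ℝ 1 (fderiv ℝ φ) := hφ.fderiv_right (by norm_num)
  exact (this.differentiable (by norm_num)).clm_apply (differentiable_const _)

lemma aux_line2 {N : ℕ} {φ : (Fin N → ℝ) → ℝ} (hφ : ContDiff ℝ 2 φ) (x ξ : Fin N → ℝ) (h : ℝ) :
    HasDerivAt (fun h : ℝ => ∑ j, ξ j * pd j φ (x + h • ξ))
      (∑ i, ∑ j, ξ i * ξ j * pd2 i j φ (x + h • ξ)) h := by
  have : HasDerivAt (fun h : ℝ => ∑ j, ξ j * pd j φ (x + h • ξ))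
      (∑ j, ξ j * ∑ i, ξ i * pd2 i j φ (x + h • ξ)) h := by
    refine HasDerivAt.fun_sum fun j _ => ?_
    exact (aux_line1 (aux_pd_diff hφ j) x ξ h).const_mul (ξ j)
  convert this using 1
  rw [Finset.sum_comm]
  refine Finset.sum_congr rfl fun j _ => ?_
  rw [Finset.mul_sum]
  refine Finset.sum_congr rfl fun i _ => by ring

open scoped MatrixOrder in
lemma aux_factor {N : ℕ} (M : Fin N → Fin N → ℝ) (hs : ∀ i j, M i j = M j i)
    (hp : ∀ ξ : Fin N → ℝ, 0 ≤ ∑ i, ∑ j, M i j * ξ i * ξ j) :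
    ∃ B : Fin N → Fin N → ℝ, ∀ i j, M i j = ∑ k, B k i * B k j := by
  have hps : (Matrix.of M).PosSemidef := by
    refine Matrix.PosSemidef.of_dotProduct_mulVec_nonneg ?_ ?_
    · ext i j; simp [hs i j]
    · intro ξ
      have := hp ξ
      simp only [dotProduct, Matrix.mulVec, Finset.mul_sum]
      refine this.trans_eq (Finset.sum_congr rfl fun i _ => Finset.sum_congr rfl fun j _ => ?_)
      simp [mul_comm, mul_left_comm]
  obtain ⟨B, hB⟩ := (CStarAlgebra.nonneg_iff_eq_star_mul_self (a := Matrix.of M)).1 hps.nonneg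
  refine ⟨B, fun i j => ?_⟩
  have := congrFun (congrFun hB i) j
  simpa [Matrix.mul_apply] using this

lemma aux_trace {N : ℕ} (M H : Fin N → Fin N → ℝ) (s : ℝ) (hs : ∀ i j, M i j = M j i)
    (hp : ∀ ξ : Fin N → ℝ, 0 ≤ ∑ i, ∑ j, M i j * ξ i * ξ j)
    (hH : ∀ ξ : Fin N → ℝ, ∑ i, ∑ j, ξ i * ξ j * H i j ≤ s * ∑ i, ξ i ^ 2) :
    ∑ i, ∑ j, M i j * H i j ≤ s * ∑ i, M i i := by
  obtain ⟨B, hB⟩ := aux_factor M hs hp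
  have h1 : ∑ i, ∑ j, M i j * H i j = ∑ k, ∑ i, ∑ j, B k i * B k j * H i j := by
    simp_rw [hB, Finset.sum_mul]
    rw [Finset.sum_comm (s := Finset.univ (α := Fin N)) (γ := Fin N)
      (f := fun k i => ∑ j, B k i * B k j * H i j)]
    refine Finset.sum_congr rfl fun i _ => ?_
    rw [Finset.sum_comm]
  have h2 : s * ∑ i, M i i = ∑ k, s * ∑ i, B k i ^ 2 := by
    rw [← Finset.mul_sum, Finset.sum_comm]
    congr 1
    refine Finset.sum_congr rfl fun i _ => ?_
    rw [hB]; refine Finset.sum_congr rfl fun k _ => by ring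
  rw [h1, h2]
  exact Finset.sum_le_sum fun k _ => hH (B k)

lemma aux_q1 {N : ℕ} (z ξ : Fin N → ℝ) (h : ℝ) :
    HasDerivAt (fun h : ℝ => ∑ i, (z i + h * ξ i) ^ 2) (2 * ∑ i, ξ i * (z i + h * ξ i)) h := by
  rw [Finset.mul_sum]
  refine HasDerivAt.fun_sum fun i _ => ?_
  have := (((hasDerivAt_id h).mul_const (ξ i)).const_add (z i)).pow 2
  refine this.congr_deriv ?_
  simp; ring

lemma aux_q2 {N : ℕ} (z ξ : Fin N → ℝ) (h : ℝ) :
    HasDerivAt (fun h : ℝ => 2 * ∑ i, ξ i * (z i + h * ξ i)) (2 * ∑ i, ξ i ^ 2) h := by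
  refine HasDerivAt.const_mul 2 (HasDerivAt.fun_sum fun i _ => ?_)
  have := (((hasDerivAt_id h).mul_const (ξ i)).const_add (z i)).const_mul (ξ i)
  refine this.congr_deriv ?_
  simp; ring

/-- The equation for the difference `v`. -/
def AuxEq {N : ℕ} (a : Fin N → Fin N → (Fin N → ℝ) → ℝ → ℝ)
    (b : Fin N → (Fin N → ℝ) → ℝ → ℝ) (c v : (Fin N → ℝ) → ℝ → ℝ) : Prop :=
  ∀ x t, deriv (fun s => v x s) t = (∑ i, ∑ j, a i j x t * pd2 i j (fun y => v y t) x)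
    + (∑ i, b i x t * pd i (fun y => v y t) x) + c x t * v x t

set_option maxHeartbeats 1600000 in
lemma aux_barrier {N : ℕ} {a : Fin N → Fin N → (Fin N → ℝ) → ℝ → ℝ}
    {b : Fin N → (Fin N → ℝ) → ℝ → ℝ} {c v : (Fin N → ℝ) → ℝ → ℝ}
    (hreg : RegSol v) (heq : AuxEq a b c v) {a0 T Bb C k r ε τ : ℝ} (ha0 : 0 < a0)
    (hsym : ∀ i j x t, a i j x t = a j i x t)
    (hell : ∀ (x : Fin N → ℝ) (t : ℝ) (ξ : Fin N → ℝ),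
      a0 * ∑ i, ξ i ^ 2 ≤ ∑ i, ∑ j, a i j x t * ξ i * ξ j)
    (hT : ∀ x t, ∑ i, a i i x t ≤ T) (hBb : ∀ i x t, |b i x t| ≤ Bb) (hBb0 : 0 ≤ Bb)
    (hC : ∀ x t, -C ≤ c x t) (hc : ∀ x t, c x t ≤ 0) (hk : 0 ≤ k) (hvk : ∀ x t, v x t ≤ k)
    (hr : 0 < r) (hε : 0 < ε) (hτ : 0 < τ) (y : Fin N → ℝ) :
    ∃ δ > 0, ∀ x1 s1, (∀ x : Fin N → ℝ, ∑ i, (x i - x1 i) ^ 2 ≤ r ^ 2 → v x s1 ≤ k - ε) →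
      v (x1 + y) (s1 + τ) ≤ k - δ := by
  obtain ⟨hcont, hdt, hdx⟩ := hreg
  set β := (∑ i, y i ^ 2) / τ with hβ
  have hβ0 : 0 ≤ β := div_nonneg (Finset.sum_nonneg fun i _ => sq_nonneg _) hτ.le
  have hβτ : β * τ = ∑ i, y i ^ 2 := by rw [hβ]; field_simp
  set A := 2 * β + 4 * T + 4 * Bb * (N + (r ^ 2 + β * τ)) + 8 * a0 with hA
  set lam := C + A ^ 2 / (16 * a0 * r ^ 2) with hlam
  set κ := ε / r ^ 4 with hκ
  have hκ0 : 0 < κ := by positivity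
  refine ⟨κ * (Real.exp (-lam * τ) * (r ^ 2) ^ 2), by positivity, fun x1 s1 hini => ?_⟩
  set q : (Fin N → ℝ) → ℝ → ℝ := fun x s => r ^ 2 + β * (s - s1) - ∑ i, (x i - x1 i) ^ 2 with hq
  set F : (Fin N → ℝ) × ℝ → ℝ := fun p =>
    v p.1 p.2 + κ * (Real.exp (-lam * (p.2 - s1)) * (q p.1 p.2) ^ 2) with hF
  have hqc : Continuous fun p : (Fin N → ℝ) × ℝ => q p.1 p.2 := by
    simp only [hq]; fun_prop
  have hFc : Continuous F := by
    simp only [hF]; fun_prop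
  set S : Set ((Fin N → ℝ) × ℝ) := {p | 0 ≤ q p.1 p.2 ∧ s1 ≤ p.2 ∧ p.2 ≤ s1 + τ} with hS
  have hScl : IsClosed S :=
    (isClosed_le continuous_const hqc).inter
      ((isClosed_le continuous_const continuous_snd).inter
        (isClosed_le continuous_snd continuous_const))
  have hSsub : S ⊆ Metric.closedBall x1 (1 + (r ^ 2 + β * τ)) ×ˢ Set.Icc s1 (s1 + τ) := by
    rintro ⟨x, s⟩ ⟨h1, h2, h3⟩
    simp only at h1 h2 h3
    refine ⟨?_, h2, h3⟩
    simp only [Metric.mem_closedBall]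
    rw [dist_pi_le_iff (by positivity)]
    intro i
    have h4 : (x i - x1 i) ^ 2 ≤ ∑ i, (x i - x1 i) ^ 2 :=
      Finset.single_le_sum (f := fun i => (x i - x1 i) ^ 2) (fun i _ => sq_nonneg _)
        (Finset.mem_univ i)
    have h5 : β * (s - s1) ≤ β * τ := mul_le_mul_of_nonneg_left (by linarith) hβ0
    simp only [hq] at h1
    rw [Real.dist_eq]
    have : |x i - x1 i| ^ 2 = (x i - x1 i) ^ 2 := sq_abs _
    nlinarith [abs_nonneg (x i - x1 i), sq_nonneg (|x i - x1 i| - 1)]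
  have hScomp : IsCompact S :=
    ((isCompact_closedBall _ _).prod isCompact_Icc).of_isClosed_subset hScl hSsub
  have hend : (x1 + y, s1 + τ) ∈ S := by
    refine ⟨?_, by simp [hτ.le], by simp⟩
    simp only [hq, Pi.add_apply, add_sub_cancel_left, hβτ]
    nlinarith
  obtain ⟨⟨x, s⟩, hxS, hmax⟩ := hScomp.exists_isMaxOn ⟨_, hend⟩ hFc.continuousOn
  have key : F (x, s) ≤ k := by
    by_contra hgt
    push Not at hgt
    obtain ⟨h1, h2, h3⟩ := hxS
    simp only at h1 h2 h3
    have hqpos : 0 < q x s := by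
      rcases h1.lt_or_eq with h | h
      · exact h
      · exfalso
        simp only [hF, ← h] at hgt
        have := hvk x s
        norm_num at hgt
        linarith
    have hspos : s1 < s := by
      rcases h2.lt_or_eq with h | h
      · exact h
      · exfalso
        subst h
        simp only [hF, hq] at hgt
        simp only [hq] at hqpos
        norm_num at hgt hqpos
        have e1 := hini x hqpos.le
        have e2 : κ * (r ^ 2 - ∑ i, (x i - x1 i) ^ 2) ^ 2 ≤ ε := by
          have : ε = κ * (r ^ 2) ^ 2 := by rw [hκ]; field_simp
          rw [this]
          have : 0 ≤ ∑ i, (x i - x1 i) ^ 2 := Finset.sum_nonneg fun i _ => sq_nonneg _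
          gcongr
          linarith
        linarith
    set E := Real.exp (-lam * (s - s1)) with hE
    have hEpos : 0 < E := Real.exp_pos _
    set z : Fin N → ℝ := fun i => x i - x1 i with hz
    set Q := r ^ 2 + β * (s - s1) with hQ
    have hqz : q x s = Q - ∑ i, z i ^ 2 := rfl
    -- time derivative
    have htime : 0 ≤ deriv (fun s => v x s) s
        + κ * (E * (2 * β * q x s) - lam * E * (q x s) ^ 2) := by
      obtain ⟨s2, hs2, hs2'⟩ : ∃ s2, s2 < s ∧ ∀ s', s2 < s' → s' ≤ s → 0 ≤ q x s' := by
        have hcq : ContinuousAt (fun s' => q x s') s := by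
          simp only [hq]; fun_prop
        have := hcq.eventually (lt_mem_nhds hqpos)
        obtain ⟨l, hl, hl'⟩ := exists_Ioc_subset_of_mem_nhds this ⟨s1, hspos⟩
        exact ⟨l, hl, fun s' h1 h2 => (hl' ⟨h1, h2⟩ : 0 < q x s').le⟩
      refine aux_left (g := fun s' => F (x, s')) (s := s) (s1 := max s1 s2) (max_lt hspos hs2) ?_ ?_
      · simp only [hF]
        refine ((hdt x s).hasDerivAt).add (HasDerivAt.const_mul κ ?_)
        have d1 : HasDerivAt (fun s' => Real.exp (-lam * (s' - s1))) (E * (-lam * 1)) s :=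
          ((((hasDerivAt_id s).sub_const s1).const_mul (-lam))).exp
        have d2 : HasDerivAt (fun s' => q x s') (β * 1) s :=
          ((((hasDerivAt_id s).sub_const s1).const_mul β).const_add (r ^ 2)).sub_const _
        have d3 : HasDerivAt (fun s' => (q x s') ^ 2) (2 * q x s * β) s := by
          refine (d2.pow 2).congr_deriv ?_
          generalize q x s = w
          norm_num
        refine (d1.mul d3).congr_deriv ?_
        change E * (-lam * 1) * (q x s) ^ 2 + E * (2 * q x s * β) = _
        ring
      · intro s' hs' hs'2
        have := max_lt_iff.1 hs'
        exact hmax (show (x, s') ∈ S from ⟨hs2' s' this.2 hs'2, this.1.le, hs'2.trans h3⟩)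
    -- space derivatives
    have hspace : ∀ ξ : Fin N → ℝ,
        (∑ i, ξ i * pd i (fun y => v y s) x + κ * E * (-(4 * q x s * ∑ i, ξ i * z i)) = 0) ∧
        (∑ i, ∑ j, ξ i * ξ j * pd2 i j (fun y => v y s) x
          + κ * E * (8 * (∑ i, ξ i * z i) ^ 2 - 4 * q x s * ∑ i, ξ i ^ 2) ≤ 0) := by
      intro ξ
      set g : ℝ → ℝ := fun h => v (x + h • ξ) s
        + κ * E * (Q - ∑ i, (z i + h * ξ i) ^ 2) ^ 2 with hg
      have hgF : ∀ h, g h = F (x + h • ξ, s) := by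
        intro h
        have e : ∑ i, (z i + h * ξ i) ^ 2 = ∑ i, ((x + h • ξ) i - x1 i) ^ 2 := by
          refine Finset.sum_congr rfl fun i _ => ?_
          have : z i = x i - x1 i := rfl
          rw [this, Pi.add_apply, Pi.smul_apply, smul_eq_mul]; ring
        have : F (x + h • ξ, s) = v (x + h • ξ) s
          + κ * (E * (Q - ∑ i, ((x + h • ξ) i - x1 i) ^ 2) ^ 2) := rfl
        rw [this, ← e, ← mul_assoc]
      have hloc : IsLocalMax g 0 := by
        have hcq : ContinuousAt (fun h : ℝ => q (x + h • ξ) s) 0 := by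
          simp only [hq]; fun_prop
        have := hcq.eventually (lt_mem_nhds (show 0 < q (x + (0:ℝ) • ξ) s by simpa using hqpos))
        filter_upwards [this] with h hh
        rw [hgF, hgF, zero_smul, add_zero]
        exact hmax (show (x + h • ξ, s) ∈ S from ⟨hh.le, h2, h3⟩)
      have D := aux_second (g := g)
        (g' := fun h => ∑ i, ξ i * pd i (fun y => v y s) (x + h • ξ) + κ * E *
          (2 * (Q - ∑ i, (z i + h * ξ i) ^ 2) * (-(2 * ∑ i, ξ i * (z i + h * ξ i)))))
        (g2 := ∑ i, ∑ j, ξ i * ξ j * pd2 i j (fun y => v y s) (x + (0:ℝ) • ξ) + κ * E *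
          (2 * (-(2 * ∑ i, ξ i * (z i + 0 * ξ i))) * (-(2 * ∑ i, ξ i * (z i + 0 * ξ i)))
          + 2 * (Q - ∑ i, (z i + 0 * ξ i) ^ 2) * (-(2 * ∑ i, ξ i ^ 2))))
        (Eventually.of_forall fun h => ?_) ?_ hloc
      · simp only [zero_mul, add_zero, zero_smul, ← hqz] at D
        refine ⟨?_, ?_⟩
        · rw [← D.1]; ring
        · refine le_trans (le_of_eq ?_) D.2; ring
      · refine (aux_line1 ((hdx s).differentiable (by norm_num)) x ξ h).add
          (HasDerivAt.const_mul _ ?_)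
        refine (((aux_q1 z ξ h).const_sub Q).pow 2).congr_deriv ?_
        simp
      · refine (aux_line2 (hdx s) x ξ 0).add (HasDerivAt.const_mul _ ?_)
        exact (((aux_q1 z ξ 0).const_sub Q).const_mul 2).mul ((aux_q2 z ξ 0).neg)
    have hgrad : ∀ i, pd i (fun y => v y s) x = κ * E * (4 * q x s * z i) := by
      intro i
      have := (hspace (Pi.single i 1)).1
      simp [Pi.single_apply] at this
      linarith
    have htr := aux_trace (fun i j => a i j x s)
      (fun i j => pd2 i j (fun y => v y s) x + κ * E * (8 * (z i * z j)))
      (κ * E * (4 * q x s)) (fun i j => hsym i j x s)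
      (fun ξ => le_trans (mul_nonneg ha0.le (Finset.sum_nonneg fun i _ => sq_nonneg _)) (hell x s ξ))
      (by
        intro ξ
        have := (hspace ξ).2
        have e : ∑ i, ∑ j, ξ i * ξ j * (pd2 i j (fun y => v y s) x + κ * E * (8 * (z i * z j)))
          = ∑ i, ∑ j, ξ i * ξ j * pd2 i j (fun y => v y s) x + κ * E * (8 * (∑ i, ξ i * z i) ^ 2) := by
          rw [sq (∑ i, ξ i * z i), Finset.sum_mul_sum]
          simp only [Finset.mul_sum, ← Finset.sum_add_distrib]
          refine Finset.sum_congr rfl fun i _ => Finset.sum_congr rfl fun j _ => by ring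
        rw [e]; linarith)
    have e2 : ∑ i, ∑ j, a i j x s * (pd2 i j (fun y => v y s) x + κ * E * (8 * (z i * z j)))
        = ∑ i, ∑ j, a i j x s * pd2 i j (fun y => v y s) x
          + κ * E * (8 * ∑ i, ∑ j, a i j x s * z i * z j) := by
      simp only [Finset.mul_sum, ← Finset.sum_add_distrib]
      refine Finset.sum_congr rfl fun i _ => Finset.sum_congr rfl fun j _ => by ring
    rw [e2] at htr
    have hQle : Q ≤ r ^ 2 + β * τ := by
      have : β * (s - s1) ≤ β * τ := mul_le_mul_of_nonneg_left (by linarith) hβ0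
      linarith
    have hQge : r ^ 2 ≤ Q := by
      have : 0 ≤ β * (s - s1) := mul_nonneg hβ0 (by linarith)
      linarith
    have hb : ∑ i, b i x s * pd i (fun y => v y s) x
        ≤ κ * E * (4 * q x s * (Bb * (N + (r ^ 2 + β * τ)))) := by
      have h1 : ∑ i, b i x s * pd i (fun y => v y s) x
          = κ * E * (4 * q x s * ∑ i, b i x s * z i) := by
        simp only [Finset.mul_sum]
        refine Finset.sum_congr rfl fun i _ => by rw [hgrad]; ring
      rw [h1]
      have h2 : ∑ i, b i x s * z i ≤ ∑ i : Fin N, Bb * (1 + z i ^ 2) := by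
        refine Finset.sum_le_sum fun i _ => ?_
        calc b i x s * z i ≤ |b i x s| * |z i| := by rw [← abs_mul]; exact le_abs_self _
          _ ≤ Bb * (1 + z i ^ 2) := by
            gcongr
            · exact hBb i x s
            · nlinarith [sq_abs (z i), sq_nonneg (|z i| - 1), abs_nonneg (z i)]
      have h3 : ∑ i : Fin N, Bb * (1 + z i ^ 2) = Bb * (N + ∑ i, z i ^ 2) := by
        rw [← Finset.mul_sum, Finset.sum_add_distrib]; simp
      have h4 : ∑ i, z i ^ 2 ≤ r ^ 2 + β * τ := by linarith
      have h5 : Bb * (N + ∑ i, z i ^ 2) ≤ Bb * (N + (r ^ 2 + β * τ)) := by gcongr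
      gcongr
      linarith
    have hcv : c x s * v x s ≤ κ * E * (C * (q x s) ^ 2) := by
      have h1 : k - κ * (E * (q x s) ^ 2) < v x s := by
        have : k < v x s + κ * (E * (q x s) ^ 2) := hgt
        linarith
      have h2 : c x s * v x s ≤ c x s * (k - κ * (E * (q x s) ^ 2)) :=
        mul_le_mul_of_nonpos_left h1.le (hc x s)
      have h3 : c x s * k ≤ 0 := mul_nonpos_of_nonpos_of_nonneg (hc x s) hk
      have h4 : 0 ≤ κ * (E * (q x s) ^ 2) := by positivity
      have h5 : (-c x s) * (κ * (E * (q x s) ^ 2)) ≤ C * (κ * (E * (q x s) ^ 2)) :=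
        mul_le_mul_of_nonneg_right (by linarith [hC x s]) h4
      linarith
    have hell' := hell x s z
    have hTt := hT x s
    rw [heq x s] at htime
    have hκE : 0 < κ * E := by positivity
    have hfin : 0 ≤ κ * E * (2 * β * q x s - lam * (q x s) ^ 2
        + 4 * q x s * (∑ i, a i i x s) - 8 * (∑ i, ∑ j, a i j x s * z i * z j)
        + 4 * q x s * (Bb * (N + (r ^ 2 + β * τ))) + C * (q x s) ^ 2) := by
      linarith
    have hfin2 := nonneg_of_mul_nonneg_right hfin hκE
    have f1 : 4 * q x s * (∑ i, a i i x s) ≤ 4 * q x s * T := by gcongr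
    have f2 : a0 * (r ^ 2 - q x s) ≤ a0 * ∑ i, z i ^ 2 := by gcongr; linarith
    have f3 : A * q x s ≤ A ^ 2 / (16 * a0 * r ^ 2) * (q x s) ^ 2 + 4 * a0 * r ^ 2 := by
      have hw : 0 < a0 * r ^ 2 := by positivity
      have : A ^ 2 / (16 * a0 * r ^ 2) * (q x s) ^ 2 + 4 * a0 * r ^ 2 - A * q x s
        = (A * q x s - 8 * a0 * r ^ 2) ^ 2 / (16 * a0 * r ^ 2) := by
        field_simp; ring
      have h6 : 0 ≤ (A * q x s - 8 * a0 * r ^ 2) ^ 2 / (16 * a0 * r ^ 2) := by positivity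
      linarith
    have f4 : 0 < a0 * r ^ 2 := by positivity
    have f5 : lam * (q x s) ^ 2 = C * (q x s) ^ 2 + A ^ 2 / (16 * a0 * r ^ 2) * (q x s) ^ 2 := by
      rw [hlam]; ring
    have f6 : A * q x s = 2 * β * q x s + 4 * q x s * T
        + 4 * q x s * (Bb * (N + (r ^ 2 + β * τ))) + 8 * a0 * q x s := by rw [hA]; ring
    linarith
  have hle : F (x1 + y, s1 + τ) ≤ k := le_trans (hmax hend) key
  have hval : F (x1 + y, s1 + τ)
      = v (x1 + y) (s1 + τ) + κ * (Real.exp (-lam * τ) * (r ^ 2) ^ 2) := by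
    simp only [hF, hq, Pi.add_apply, add_sub_cancel_left, hβτ, add_sub_cancel_right]
  linarith

lemma aux_coupling {N : ℕ} (A1 A2 X Y : Fin N → Fin N → ℝ) (z : Fin N → ℝ)
    {a0 θ ω P3 P7 L A T q : ℝ} (ha0 : 0 < a0) (hL : 0 ≤ L) (hA : 0 ≤ A)
    (hθ : 0 ≤ θ) (hθ2 : θ ≤ a0 / 2) (hωθ : ω ≤ θ) (hNω : N * ω ≤ θ)
    (hq : ∑ i, z i ^ 2 = q) (hq0 : 0 < q) (hP7 : 0 ≤ P7) (hP : P7 * q = P3)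
    (hs1 : ∀ i j, A1 i j = A1 j i) (hs2 : ∀ i j, A2 i j = A2 j i)
    (hell : ∀ ξ : Fin N → ℝ, a0 * ∑ i, ξ i ^ 2 ≤ ∑ i, ∑ j, A1 i j * ξ i * ξ j)
    (hT : ∑ i, A1 i i ≤ T) (hcl : ∀ i j, |A2 i j - A1 i j| ≤ ω)
    (hst : ∀ ξ η : Fin N → ℝ, ∑ i, ∑ j, ξ i * ξ j * X i j - ∑ i, ∑ j, η i * η j * Y i j
      ≤ L * (1 / 2 * P3 * ∑ i, (ξ i - η i) ^ 2 - 3 / 4 * P7 * (∑ i, (ξ i - η i) * z i) ^ 2)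
        + 2 * A * ∑ i, ξ i ^ 2) :
    ∑ i, ∑ j, A1 i j * X i j - ∑ i, ∑ j, A2 i j * Y i j
      ≤ 2 * A * (T + a0 / 2 + N * θ) + L * P3 * (-(a0 / 2) + 3 / 2 * (N * θ)) := by
  have hP3 : 0 ≤ P3 := by rw [← hP]; positivity
  set κ := a0 / 2 with hκ
  have hκ0 : 0 < κ := by positivity
  -- synchronous part
  have hdiag : ∀ ξ : Fin N → ℝ, ∑ i, ∑ j, (if i = j then θ else 0) * ξ i * ξ j
      = θ * ∑ i, ξ i ^ 2 := by
    intro ξ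
    rw [Finset.mul_sum]
    refine Finset.sum_congr rfl fun i _ => ?_
    simp [ite_mul]; ring
  have hdiag2 : ∀ W : Fin N → Fin N → ℝ, ∑ i, ∑ j, (if i = j then θ else 0) * W i j
      = θ * ∑ i, W i i := by
    intro W
    rw [Finset.mul_sum]
    refine Finset.sum_congr rfl fun i _ => ?_
    simp [ite_mul]
  have h1 := aux_trace (fun i j => A1 i j - (if i = j then θ else 0) - κ / q * (z i * z j))
    (fun i j => X i j - Y i j) (2 * A)
    (by
      intro i j
      simp only [hs1 i j, eq_comm (a := i) (b := j), mul_comm (z i) (z j)])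
    (by
      intro ξ
      have e : ∑ i, ∑ j, (A1 i j - (if i = j then θ else 0) - κ / q * (z i * z j)) * ξ i * ξ j
          = ∑ i, ∑ j, A1 i j * ξ i * ξ j - θ * ∑ i, ξ i ^ 2 - κ / q * (∑ i, z i * ξ i) ^ 2 := by
        rw [← hdiag, sq (∑ i, z i * ξ i), Finset.sum_mul_sum]
        simp only [Finset.mul_sum, ← Finset.sum_sub_distrib]
        refine Finset.sum_congr rfl fun i _ => Finset.sum_congr rfl fun j _ => by ring
      rw [e]
      have cs := Finset.sum_mul_sq_le_sq_mul_sq Finset.univ z ξ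
      rw [hq] at cs
      have : κ / q * (∑ i, z i * ξ i) ^ 2 ≤ κ * ∑ i, ξ i ^ 2 := by
        calc κ / q * (∑ i, z i * ξ i) ^ 2 ≤ κ / q * (q * ∑ i, ξ i ^ 2) := by gcongr
          _ = κ * ∑ i, ξ i ^ 2 := by field_simp
      have h0 : 0 ≤ ∑ i, ξ i ^ 2 := Finset.sum_nonneg fun i _ => sq_nonneg _
      have := hell ξ
      nlinarith)
    (by
      intro ξ
      have := hst ξ ξ
      simp only [sub_self] at this
      have e : ∑ i, ∑ j, ξ i * ξ j * (X i j - Y i j)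
          = ∑ i, ∑ j, ξ i * ξ j * X i j - ∑ i, ∑ j, ξ i * ξ j * Y i j := by
        simp only [mul_sub, Finset.sum_sub_distrib]
      rw [e]
      simpa using this)
  -- correction part
  have h2 := aux_trace (fun i j => A2 i j - A1 i j + (if i = j then θ else 0))
    (fun i j => - Y i j) (L * (1 / 2 * P3))
    (by
      intro i j
      simp only [hs1 i j, hs2 i j, eq_comm (a := i) (b := j)])
    (by
      intro ξ
      have e : ∑ i, ∑ j, (A2 i j - A1 i j + (if i = j then θ else 0)) * ξ i * ξ j
          = ∑ i, ∑ j, (A2 i j - A1 i j) * ξ i * ξ j + θ * ∑ i, ξ i ^ 2 := by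
        rw [← hdiag]
        simp only [← Finset.sum_add_distrib]
        refine Finset.sum_congr rfl fun i _ => Finset.sum_congr rfl fun j _ => by ring
      rw [e]
      have h3 : ∑ i : Fin N, ∑ j : Fin N, (-(ω * (ξ i ^ 2 + ξ j ^ 2) / 2))
          ≤ ∑ i, ∑ j, (A2 i j - A1 i j) * ξ i * ξ j := by
        refine Finset.sum_le_sum fun i _ => Finset.sum_le_sum fun j _ => ?_
        have := abs_le.1 (hcl i j)
        nlinarith [sq_nonneg (ξ i + ξ j), sq_nonneg (ξ i - ξ j)]
      have h4 : ∑ i : Fin N, ∑ j : Fin N, (-(ω * (ξ i ^ 2 + ξ j ^ 2) / 2))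
          = - (N * ω * ∑ i, ξ i ^ 2) := by
        have : ∀ i j : Fin N, (-(ω * (ξ i ^ 2 + ξ j ^ 2) / 2))
          = -(ω / 2) * ξ i ^ 2 + -(ω / 2) * ξ j ^ 2 := fun i j => by ring
        simp only [this, Finset.sum_add_distrib, Finset.sum_const, Finset.card_univ,
          Fintype.card_fin, nsmul_eq_mul, ← Finset.mul_sum]
        ring
      have h0 : 0 ≤ ∑ i, ξ i ^ 2 := Finset.sum_nonneg fun i _ => sq_nonneg _
      have h5 : N * ω * ∑ i, ξ i ^ 2 ≤ θ * ∑ i, ξ i ^ 2 := by gcongr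
      linarith)
    (by
      intro ξ
      have := hst 0 ξ
      simp only [Pi.zero_apply, zero_mul, Finset.sum_const_zero, zero_sub, neg_sq] at this
      have h6 : 0 ≤ L * (3 / 4 * P7 * (∑ i, ξ i * z i) ^ 2) := by positivity
      have e : ∑ i, ∑ j, ξ i * ξ j * (- Y i j) = - ∑ i, ∑ j, ξ i * ξ j * Y i j := by
        simp only [mul_neg, Finset.sum_neg_distrib]
      rw [e]
      norm_num at this
      linarith)
  -- reflection part
  have h3 : ∑ i, ∑ j, z i * z j * X i j - ∑ i, ∑ j, z i * z j * Y i j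
      ≤ - (L * P3 * q) + 2 * A * q := by
    have := hst z (fun i => - z i)
    have e1 : ∑ i, (z i - -z i) ^ 2 = 4 * q := by
      rw [← hq, Finset.mul_sum]; refine Finset.sum_congr rfl fun i _ => by ring
    have e2 : ∑ i, (z i - -z i) * z i = 2 * q := by
      rw [← hq, Finset.mul_sum]; refine Finset.sum_congr rfl fun i _ => by ring
    simp only [e1, e2, hq, neg_mul_neg] at this
    have e3 : P7 * (2 * q) ^ 2 = 4 * (P3 * q) := by rw [← hP]; ring
    refine this.trans (le_of_eq ?_)
    linear_combination (-(3 / 4) * L) * e3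
  -- isotropic part
  have h4 : ∑ i, X i i ≤ N * (L * (1 / 2 * P3) + 2 * A) := by
    have : ∀ i, X i i ≤ L * (1 / 2 * P3) + 2 * A := by
      intro i
      have := hst (Pi.single i 1) 0
      simp only [Pi.zero_apply, zero_mul, Finset.sum_const_zero, sub_zero] at this
      have h6 : 0 ≤ L * (3 / 4 * P7 * (∑ j, (Pi.single i 1 : Fin N → ℝ) j * z j) ^ 2) := by positivity
      have e1 : ∑ j, (Pi.single i 1 : Fin N → ℝ) j ^ 2 = 1 := by
        simp [Pi.single_apply, ite_pow]
      have e2 : ∑ k, ∑ j, (Pi.single i 1 : Fin N → ℝ) k * (Pi.single i 1 : Fin N → ℝ) j * X k j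
          = X i i := by simp [Pi.single_apply]
      rw [e1, e2] at this
      linarith
    calc ∑ i, X i i ≤ ∑ i : Fin N, (L * (1 / 2 * P3) + 2 * A) := Finset.sum_le_sum fun i _ => this i
      _ = _ := by simp; ring
  have t1 : ∑ i, (A1 i i - (if i = i then θ else 0) - κ / q * (z i * z i)) ≤ T := by
    have h7 : ∀ i, 0 ≤ κ / q * (z i * z i) := fun i => mul_nonneg (by positivity) (mul_self_nonneg _)
    refine le_trans (Finset.sum_le_sum fun i _ => ?_) hT
    have := h7 i
    simp only [if_true]
    linarith
  have t2 : ∑ i, (A2 i i - A1 i i + (if i = i then θ else 0)) ≤ N * (2 * θ) := by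
    calc ∑ i, (A2 i i - A1 i i + (if i = i then θ else 0)) ≤ ∑ i : Fin N, (2 * θ) := by
          refine Finset.sum_le_sum fun i _ => ?_
          have := abs_le.1 (hcl i i)
          simp only [if_true]
          linarith
      _ = _ := by simp
  have s1 : 2 * A * ∑ i, (A1 i i - (if i = i then θ else 0) - κ / q * (z i * z i)) ≤ 2 * A * T := by
    gcongr
  have s2 : L * (1 / 2 * P3) * ∑ i, (A2 i i - A1 i i + (if i = i then θ else 0))
      ≤ L * (1 / 2 * P3) * (N * (2 * θ)) := by gcongr
  have s3 : κ / q * (∑ i, ∑ j, z i * z j * X i j - ∑ i, ∑ j, z i * z j * Y i j)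
      ≤ - (κ * L * P3) + 2 * A * κ := by
    calc _ ≤ κ / q * (- (L * P3 * q) + 2 * A * q) := by gcongr
      _ = _ := by field_simp
  have s4 : θ * ∑ i, X i i ≤ θ * (N * (L * (1 / 2 * P3) + 2 * A)) := by gcongr
  have e : ∑ i, ∑ j, A1 i j * X i j - ∑ i, ∑ j, A2 i j * Y i j
      = ∑ i, ∑ j, (A1 i j - (if i = j then θ else 0) - κ / q * (z i * z j)) * (X i j - Y i j)
      + ∑ i, ∑ j, (A2 i j - A1 i j + (if i = j then θ else 0)) * (- Y i j)
      + κ / q * (∑ i, ∑ j, z i * z j * X i j - ∑ i, ∑ j, z i * z j * Y i j)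
      + θ * ∑ i, X i i := by
    rw [← hdiag2]
    simp only [Finset.mul_sum, ← Finset.sum_sub_distrib, ← Finset.sum_add_distrib]
    refine Finset.sum_congr rfl fun i _ => Finset.sum_congr rfl fun j _ => by ring
  rw [e]
  linarith

set_option maxHeartbeats 1600000 in
lemma aux_holder {N : ℕ} {a : Fin N → Fin N → (Fin N → ℝ) → ℝ → ℝ}
    {b : Fin N → (Fin N → ℝ) → ℝ → ℝ} {c v : (Fin N → ℝ) → ℝ → ℝ}
    (hreg : RegSol v) (heq : AuxEq a b c v) {a0 T Bb G K : ℝ} (ha0 : 0 < a0)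
    (hsym : ∀ i j x t, a i j x t = a j i x t)
    (hell : ∀ (x : Fin N → ℝ) (t : ℝ) (ξ : Fin N → ℝ),
      a0 * ∑ i, ξ i ^ 2 ≤ ∑ i, ∑ j, a i j x t * ξ i * ξ j)
    (hT : ∀ x t, ∑ i, a i i x t ≤ T) (hBb : ∀ i x t, |b i x t| ≤ Bb) (hBb0 : 0 ≤ Bb)
    (hG : ∀ x t, |c x t * v x t| ≤ G) (hK0 : 0 ≤ K) (hK : ∀ x t, |v x t| ≤ K)
    (huc : ∀ ω > 0, ∃ r > 0, ∀ (x y : Fin N → ℝ) t, (∀ i, |x i - y i| ≤ r) →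
      ∀ i j, |a i j y t - a i j x t| ≤ ω) :
    ∃ L > 0, ∀ x y t, v x t - v y t ≤ L * (∑ i, (x i - y i) ^ 2) ^ (1 / 4 : ℝ) := by
  obtain ⟨hcont, hdt, hdx⟩ := hreg
  have hN0 : (0:ℝ) ≤ N := Nat.cast_nonneg N
  set θ := a0 / (12 * (N + 1)) with hθ
  have hθ0 : 0 < θ := by positivity
  have hNθ : (N + 1) * θ = a0 / 12 := by rw [hθ]; field_simp
  set ω := θ / (N + 1) with hω
  have hω0 : 0 < ω := by positivity
  have hNω : (N + 1) * ω = θ := by rw [hω]; field_simp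
  obtain ⟨r1, hr1, hucr⟩ := huc ω hω0
  set r0 := min (min r1 1) (a0 / (8 * (Bb * N + 1))) with hr0
  have hden : 0 < 8 * (Bb * N + 1) := by positivity
  have hr00 : 0 < r0 := lt_min (lt_min hr1 one_pos) (by positivity)
  have hr0r1 : r0 ≤ r1 := (min_le_left _ _).trans (min_le_left _ _)
  have hr01 : r0 ≤ 1 := (min_le_left _ _).trans (min_le_right _ _)
  have hr0B : Bb * N * r0 ≤ a0 / 8 := by
    have h1 : r0 ≤ a0 / (8 * (Bb * N + 1)) := min_le_right _ _
    rw [le_div_iff₀ hden] at h1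
    nlinarith
  set A := 2 * K with hA
  have hA0 : 0 ≤ A := by positivity
  set C0 := A + 2 * A * (T + a0 / 2 + N * θ) + 2 * A * (Bb * N) + 2 * G with hC0
  set L := max 1 (max (2 * K / (r0 ^ 2) ^ (1 / 4 : ℝ)) (4 * C0 / a0 + 1)) with hL
  have hL1 : 1 ≤ L := le_max_left _ _
  have hL0 : 0 < L := by linarith
  have hLK : 2 * K ≤ L * (r0 ^ 2) ^ (1 / 4 : ℝ) := by
    rw [← div_le_iff₀ (by positivity)]
    exact (le_max_left _ _).trans (le_max_right _ _)
  have hLC : C0 < L * (a0 / 4) := by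
    have h1 : 4 * C0 / a0 + 1 ≤ L := (le_max_right _ _).trans (le_max_right _ _)
    have h2 : 4 * C0 / a0 < L := by linarith
    rw [div_lt_iff₀ ha0] at h2
    linarith
  refine ⟨L, hL0, ?_⟩
  by_contra hneg
  push Not at hneg
  obtain ⟨x1, y1, t1, hpos⟩ := hneg
  set Ψ : (Fin N → ℝ) → (Fin N → ℝ) → ℝ → ℝ := fun x y s =>
    v x s - v y s - L * (∑ i, (x i - y i) ^ 2) ^ (1 / 4 : ℝ) - A * ∑ i, (x i - x1 i) ^ 2
      - A * (t1 - s) with hΨ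
  have hΨ1 : 0 < Ψ x1 y1 t1 := by
    simp only [hΨ]; simp; linarith
  have hv2 : ∀ x y s, v x s - v y s ≤ 2 * K := fun x y s => by
    have := abs_le.1 (hK x s); have := abs_le.1 (hK y s); linarith
  have hS0 : ∀ x y : Fin N → ℝ, 0 ≤ ∑ i, (x i - y i) ^ 2 := fun x y =>
    Finset.sum_nonneg fun i _ => sq_nonneg _
  have hreg3 : ∀ x y s, s ≤ t1 → 0 < Ψ x y s →
      ∑ i, (x i - x1 i) ^ 2 < 1 ∧ ∑ i, (x i - y i) ^ 2 < r0 ^ 2 ∧ t1 - 1 < s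
        ∧ 0 < ∑ i, (x i - y i) ^ 2 := by
    intro x y s hs hp
    simp only [hΨ] at hp
    have e1 := hv2 x y s
    have e2 : 0 ≤ L * (∑ i, (x i - y i) ^ 2) ^ (1 / 4 : ℝ) :=
      mul_nonneg hL0.le (Real.rpow_nonneg (hS0 x y) _)
    have e3 : 0 ≤ A * ∑ i, (x i - x1 i) ^ 2 := mul_nonneg hA0 (hS0 x x1)
    have e4 : 0 ≤ A * (t1 - s) := mul_nonneg hA0 (by linarith)
    refine ⟨?_, ?_, ?_, ?_⟩
    · by_contra h; push Not at h
      have : A * 1 ≤ A * ∑ i, (x i - x1 i) ^ 2 := by gcongr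
      linarith
    · by_contra h; push Not at h
      have : L * (r0 ^ 2) ^ (1 / 4 : ℝ) ≤ L * (∑ i, (x i - y i) ^ 2) ^ (1 / 4 : ℝ) := by gcongr
      linarith
    · by_contra h; push Not at h
      have : A * 1 ≤ A * (t1 - s) := by gcongr; linarith
      linarith
    · rcases (hS0 x y).lt_or_eq with h | h
      · exact h
      · exfalso
        have hxy : x = y := by
          ext i
          have := (Finset.sum_eq_zero_iff_of_nonneg (fun i _ => sq_nonneg (x i - y i))).1 h.symm i
            (Finset.mem_univ i)
          have := pow_eq_zero_iff (two_ne_zero) |>.1 this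
          linarith
        rw [hxy] at hp e2 e3
        linarith
  have hsup : ∀ (x y : Fin N → ℝ) (ρ : ℝ), 0 ≤ ρ → ∑ i, (x i - y i) ^ 2 < ρ ^ 2 →
      ∀ i, |x i - y i| ≤ ρ := by
    intro x y ρ hρ h i
    have h4 : (x i - y i) ^ 2 ≤ ∑ i, (x i - y i) ^ 2 :=
      Finset.single_le_sum (f := fun i => (x i - y i) ^ 2) (fun i _ => sq_nonneg _)
        (Finset.mem_univ i)
    exact abs_le_of_sq_le_sq (h4.trans h.le) hρ
  set S : Set ((Fin N → ℝ) × (Fin N → ℝ) × ℝ) :=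
    Metric.closedBall x1 1 ×ˢ (Metric.closedBall x1 2 ×ˢ Set.Icc (t1 - 1) t1) with hS
  have hScomp : IsCompact S :=
    (isCompact_closedBall _ _).prod ((isCompact_closedBall _ _).prod isCompact_Icc)
  have hinS : ∀ x y s, s ≤ t1 → 0 < Ψ x y s → (x, y, s) ∈ S := by
    intro x y s hs hp
    obtain ⟨f1, f2, f3, -⟩ := hreg3 x y s hs hp
    have g1 := hsup x x1 1 zero_le_one (by simpa using f1)
    have g2 := hsup x y r0 hr00.le f2
    refine ⟨?_, ?_, f3.le, hs⟩
    · simp only [Metric.mem_closedBall]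
      rw [dist_pi_le_iff (by norm_num)]
      intro i; rw [Real.dist_eq]; exact g1 i
    · simp only [Metric.mem_closedBall]
      rw [dist_pi_le_iff (by norm_num)]
      intro i; rw [Real.dist_eq]
      have h1 := abs_le.1 (g1 i)
      have h2 := abs_le.1 (g2 i)
      rw [abs_le]; constructor <;> linarith
  have hΨc : Continuous fun p : (Fin N → ℝ) × (Fin N → ℝ) × ℝ => Ψ p.1 p.2.1 p.2.2 := by
    have c1 : Continuous fun p : (Fin N → ℝ) × (Fin N → ℝ) × ℝ => v p.1 p.2.2 :=
      hcont.comp (continuous_fst.prodMk (continuous_snd.comp continuous_snd))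
    have c2 : Continuous fun p : (Fin N → ℝ) × (Fin N → ℝ) × ℝ => v p.2.1 p.2.2 :=
      hcont.comp continuous_snd
    have c3 : Continuous fun p : (Fin N → ℝ) × (Fin N → ℝ) × ℝ =>
        (∑ i, (p.1 i - p.2.1 i) ^ 2) ^ (1 / 4 : ℝ) :=
      Continuous.rpow_const (by fun_prop) (fun _ => Or.inr (by norm_num))
    simp only [hΨ]
    exact (((c1.sub c2).sub (continuous_const.mul c3)).sub (by fun_prop)).sub (by fun_prop)
  obtain ⟨⟨x, y, s⟩, hxS, hmaxS⟩ := hScomp.exists_isMaxOn ⟨_, hinS x1 y1 t1 le_rfl hΨ1⟩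
    hΨc.continuousOn
  have hst1 : s ≤ t1 := hxS.2.2.2
  have hΨp : 0 < Ψ x y s := lt_of_lt_of_le hΨ1 (hmaxS (hinS x1 y1 t1 le_rfl hΨ1))
  have hmax : ∀ x' y' s', s' ≤ t1 → Ψ x' y' s' ≤ Ψ x y s := by
    intro x' y' s' hs'
    by_cases hp : 0 < Ψ x' y' s'
    · exact hmaxS (hinS x' y' s' hs' hp)
    · push Not at hp; linarith
  obtain ⟨hr_x, hr_xy, hr_s, hr_q⟩ := hreg3 x y s hst1 hΨp
  have hxy_i := hsup x y r0 hr00.le hr_xy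
  have hxx_i := hsup x x1 1 zero_le_one (by simpa using hr_x)
  set z : Fin N → ℝ := fun i => x i - y i with hz
  set q := ∑ i, z i ^ 2 with hq
  have hq0 : 0 < q := hr_q
  have hq1 : q ≤ 1 := by
    have : r0 ^ 2 ≤ 1 := by nlinarith
    have : q < r0 ^ 2 := hr_xy
    linarith
  set P3 := q ^ (-(3 / 4) : ℝ) with hP3
  set P7 := q ^ (-(7 / 4) : ℝ) with hP7
  have hP : P7 * q = P3 := by
    rw [hP7, hP3]
    nth_rewrite 2 [← Real.rpow_one q]
    rw [← Real.rpow_add hq0]; norm_num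
  have hP70 : 0 ≤ P7 := Real.rpow_nonneg hq0.le _
  have hP31 : 1 ≤ P3 := Real.one_le_rpow_of_pos_of_le_one_of_nonpos hq0 hq1 (by norm_num)
  -- time derivative
  have htime : 0 ≤ deriv (fun s => v x s) s - deriv (fun s => v y s) s + A := by
    refine aux_left (g := fun s' => Ψ x y s') (s := s) (s1 := s - 1) (by linarith) ?_ ?_
    · have d := ((((hdt x s).hasDerivAt).sub ((hdt y s).hasDerivAt)).sub_const
        (L * (∑ i, (x i - y i) ^ 2) ^ (1 / 4 : ℝ))).sub_const (A * ∑ i, (x i - x1 i) ^ 2)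
      have d2 : HasDerivAt (fun s' : ℝ => A * (t1 - s')) (A * (-1)) s :=
        ((hasDerivAt_id s).const_sub t1).const_mul A
      refine (d.sub d2).congr_deriv ?_
      ring
    · intro s' _ hs'
      exact hmax x y s' (hs'.trans hst1)
  -- space derivatives
  have hspace : ∀ ξ η : Fin N → ℝ,
      (∑ i, ξ i * pd i (fun y => v y s) x - ∑ i, η i * pd i (fun y => v y s) y
        = L * (1 / 2 * P3 * ∑ i, (ξ i - η i) * z i) + 2 * A * ∑ i, ξ i * (x i - x1 i)) ∧
      (∑ i, ∑ j, ξ i * ξ j * pd2 i j (fun y => v y s) x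
        - ∑ i, ∑ j, η i * η j * pd2 i j (fun y => v y s) y
        ≤ L * (1 / 2 * P3 * ∑ i, (ξ i - η i) ^ 2 - 3 / 4 * P7 * (∑ i, (ξ i - η i) * z i) ^ 2)
          + 2 * A * ∑ i, ξ i ^ 2) := by
    intro ξ η
    set d : Fin N → ℝ := fun i => ξ i - η i with hd
    set w : Fin N → ℝ := fun i => x i - x1 i with hw
    set Z : ℝ → ℝ := fun h => ∑ i, (z i + h * d i) ^ 2 with hZ
    set Z' : ℝ → ℝ := fun h => 2 * ∑ i, d i * (z i + h * d i) with hZ'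
    have hZ0 : Z 0 = q := by simp [hZ, hq]
    have hZ'0 : Z' 0 = 2 * ∑ i, d i * z i := by simp [hZ']
    have hZd : ∀ h, HasDerivAt Z (Z' h) h := fun h => aux_q1 z d h
    have hZd' : HasDerivAt Z' (2 * ∑ i, d i ^ 2) 0 := aux_q2 z d 0
    set g : ℝ → ℝ := fun h => v (x + h • ξ) s - v (y + h • η) s - L * (Z h) ^ (1 / 4 : ℝ)
      - A * (∑ i, (w i + h * ξ i) ^ 2) - A * (t1 - s) with hg
    have hgF : ∀ h, g h = Ψ (x + h • ξ) (y + h • η) s := by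
      intro h
      have e1 : Z h = ∑ i, ((x + h • ξ) i - (y + h • η) i) ^ 2 := by
        refine Finset.sum_congr rfl fun i _ => ?_
        change ((x i - y i) + h * (ξ i - η i)) ^ 2 = _
        rw [Pi.add_apply, Pi.smul_apply, smul_eq_mul, Pi.add_apply, Pi.smul_apply, smul_eq_mul]
        ring
      have e2 : ∑ i, (w i + h * ξ i) ^ 2 = ∑ i, ((x + h • ξ) i - x1 i) ^ 2 := by
        refine Finset.sum_congr rfl fun i _ => ?_
        change ((x i - x1 i) + h * ξ i) ^ 2 = _
        rw [Pi.add_apply, Pi.smul_apply, smul_eq_mul]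
        ring
      change _ = v (x + h • ξ) s - v (y + h • η) s
        - L * (∑ i, ((x + h • ξ) i - (y + h • η) i) ^ 2) ^ (1 / 4 : ℝ)
        - A * ∑ i, ((x + h • ξ) i - x1 i) ^ 2 - A * (t1 - s)
      rw [← e1, ← e2]
    have hloc : IsLocalMax g 0 := by
      refine Eventually.of_forall fun h => ?_
      rw [hgF, hgF, zero_smul, add_zero, zero_smul, add_zero]
      exact hmax _ _ s hst1
    have hZpos : ∀ᶠ h in 𝓝 (0:ℝ), 0 < Z h :=
      (hZd 0).continuousAt.eventually (lt_mem_nhds (by rw [hZ0]; exact hq0))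
    have D := aux_second (g := g)
      (g' := fun h => ∑ i, ξ i * pd i (fun y => v y s) (x + h • ξ)
        - ∑ i, η i * pd i (fun y => v y s) (y + h • η)
        - L * (1 / 4 * (Z' h * (Z h) ^ (-(3 / 4) : ℝ)))
        - A * (2 * ∑ i, ξ i * (w i + h * ξ i)))
      (g2 := ∑ i, ∑ j, ξ i * ξ j * pd2 i j (fun y => v y s) (x + (0:ℝ) • ξ)
        - ∑ i, ∑ j, η i * η j * pd2 i j (fun y => v y s) (y + (0:ℝ) • η)
        - L * (1 / 4 * ((2 * ∑ i, d i ^ 2) * (Z 0) ^ (-(3 / 4) : ℝ)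
            + Z' 0 * (Z' 0 * (-(3 / 4)) * (Z 0) ^ (-(3 / 4) - 1 : ℝ))))
        - A * (2 * ∑ i, ξ i ^ 2))
      (hZpos.mono fun h hh => ?_) ?_ hloc
    · have e7 : (-(3 / 4) - 1 : ℝ) = -(7 / 4) := by norm_num
      simp only [zero_smul, add_zero, zero_mul, hZ0, hZ'0, e7] at D
      obtain ⟨D1, D2⟩ := D
      have i1 : q ^ (-(3 / 4) : ℝ) = P3 := rfl
      have i2 : q ^ (-(7 / 4) : ℝ) = P7 := rfl
      rw [i1] at D1 D2
      rw [i2] at D2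
      constructor
      · linarith
      · linarith
    · refine ((((aux_line1 ((hdx s).differentiable (by norm_num)) x ξ h).sub
        (aux_line1 ((hdx s).differentiable (by norm_num)) y η h)).sub
          (HasDerivAt.const_mul L ?_)).sub ((aux_q1 w ξ h).const_mul A)).sub_const _
      refine ((hZd h).rpow_const (p := 1 / 4) (Or.inl hh.ne')).congr_deriv ?_
      norm_num; ring
    · refine (((aux_line2 (hdx s) x ξ 0).sub (aux_line2 (hdx s) y η 0)).sub
          (HasDerivAt.const_mul L (HasDerivAt.const_mul _ ?_))).sub ((aux_q2 w ξ 0).const_mul A)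
      exact hZd'.mul ((hZd 0).rpow_const (p := -(3 / 4)) (Or.inl (by rw [hZ0]; exact hq0.ne')))
  have hgy : ∀ i, pd i (fun y => v y s) y = L * (1 / 2 * P3 * z i) := by
    intro i
    have := (hspace 0 (Pi.single i 1)).1
    simp [Pi.single_apply] at this
    linarith
  have hgx : ∀ i, pd i (fun y => v y s) x = L * (1 / 2 * P3 * z i) + 2 * A * (x i - x1 i) := by
    intro i
    have := (hspace (Pi.single i 1) 0).1
    simp [Pi.single_apply] at this
    linarith
  have hθ1 : θ ≤ a0 / 12 := by nlinarith
  have hωθ : ω ≤ θ := by nlinarith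
  have hNω' : N * ω ≤ θ := by linarith
  have hcoup := aux_coupling (fun i j => a i j x s) (fun i j => a i j y s)
    (fun i j => pd2 i j (fun y => v y s) x) (fun i j => pd2 i j (fun y => v y s) y) z
    ha0 hL0.le hA0 hθ0.le (by linarith) hωθ hNω' rfl hq0 hP70 hP
    (fun i j => hsym i j x s) (fun i j => hsym i j y s) (hell x s) (hT x s)
    (hucr x y s fun i => (hxy_i i).trans hr0r1) (fun ξ η => (hspace ξ η).2)
  have hb : ∑ i, b i x s * pd i (fun y => v y s) x - ∑ i, b i y s * pd i (fun y => v y s) y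
      ≤ L * P3 * (Bb * N * r0) + 2 * A * (Bb * N) := by
    rw [← Finset.sum_sub_distrib]
    calc _ ≤ ∑ i : Fin N, (L * P3 * (Bb * r0) + 2 * A * Bb) := by
          refine Finset.sum_le_sum fun i _ => ?_
          rw [hgx, hgy]
          have k1 : (b i x s - b i y s) * z i ≤ 2 * Bb * r0 := by
            calc (b i x s - b i y s) * z i ≤ |b i x s - b i y s| * |z i| := by
                  rw [← abs_mul]; exact le_abs_self _
              _ ≤ 2 * Bb * r0 := by
                have := hxy_i i
                have h1 := abs_le.1 (hBb i x s)
                have h2 := abs_le.1 (hBb i y s)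
                have h3 : |b i x s - b i y s| ≤ 2 * Bb := by
                  rw [abs_le]; constructor <;> linarith
                gcongr
          have k2 : b i x s * (x i - x1 i) ≤ Bb := by
            calc b i x s * (x i - x1 i) ≤ |b i x s| * |x i - x1 i| := by
                  rw [← abs_mul]; exact le_abs_self _
              _ ≤ Bb * 1 := by
                have := hxx_i i
                have := hBb i x s
                gcongr
              _ = Bb := mul_one _
          have k3 : L * P3 * ((b i x s - b i y s) * z i) ≤ L * P3 * (2 * Bb * r0) :=
            mul_le_mul_of_nonneg_left k1 (by positivity)
          have k4 : 2 * A * (b i x s * (x i - x1 i)) ≤ 2 * A * Bb :=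
            mul_le_mul_of_nonneg_left k2 (by positivity)
          linarith
      _ = _ := by simp; ring
  have hcx := abs_le.1 (hG x s)
  have hcy := abs_le.1 (hG y s)
  rw [heq x s, heq y s] at htime
  have hfin : 0 ≤ C0 + L * P3 * (-(a0 / 2) + 3 / 2 * (N * θ) + Bb * N * r0) := by
    rw [hC0]; linarith
  have hNθ' : N * θ ≤ a0 / 12 := by linarith
  have hLP : L ≤ L * P3 := by nlinarith
  have h1 : L * P3 * (-(a0 / 2) + 3 / 2 * (N * θ) + Bb * N * r0) ≤ L * P3 * (-(a0 / 4)) := by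
    refine mul_le_mul_of_nonneg_left ?_ (by linarith)
    linarith
  have h2 : L * (a0 / 4) ≤ L * P3 * (a0 / 4) := mul_le_mul_of_nonneg_right hLP (by positivity)
  linarith

lemma aux_pd_shift {N : ℕ} (i : Fin N) {φ ψ : (Fin N → ℝ) → ℝ} (h : Fin N → ℝ)
    (hφ : Differentiable ℝ φ) (hψ : Differentiable ℝ ψ) (x : Fin N → ℝ) :
    pd i (fun y => φ (y + h) - ψ y) x = pd i φ (x + h) - pd i ψ x := by
  unfold pd
  have h1 : DifferentiableAt ℝ (fun y => φ (y + h)) x :=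
    (hφ (x + h)).comp x (differentiableAt_id.add_const h)
  rw [fderiv_fun_sub h1 (hψ x), fderiv_comp_add_right]
  rfl

lemma aux_main {N : ℕ} {a : Fin N → Fin N → (Fin N → ℝ) → ℝ → ℝ}
    {b : Fin N → (Fin N → ℝ) → ℝ → ℝ} {c f u : (Fin N → ℝ) → ℝ → ℝ}
    (hstd : StdCoeffs a b c) (hc : ∀ x t, c x t ≤ 0) (h : Fin N → ℝ) (σ : ℝ)
    (hap : ∀ i j x t, a i j (x + h) (t + σ) = a i j x t)
    (hbp : ∀ i x t, b i (x + h) (t + σ) = b i x t)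
    (hcp : ∀ x t, c (x + h) (t + σ) = c x t) (hfp : ∀ x t, f (x + h) (t + σ) = f x t)
    (hsol : IsSol a b c f u) (hbdd : Bdd2 u) (x : Fin N → ℝ) (t : ℝ) :
    u (x + h) (t + σ) ≤ u x t := by
  obtain ⟨hab, hauc, hbb, -, ⟨C, hC⟩, -, hsym, a0, a1, ha0, -, hell⟩ := hstd
  obtain ⟨⟨hcont, hdt, hdx⟩, hequ⟩ := hsol
  obtain ⟨M, hM⟩ := hbdd
  set v : (Fin N → ℝ) → ℝ → ℝ := fun x t => u (x + h) (t + σ) - u x t with hv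
  have hM0 : 0 ≤ M := (abs_nonneg _).trans (hM x t)
  have hC0 : 0 ≤ C := (abs_nonneg _).trans (hC x t)
  have hdx1 : ∀ t, Differentiable ℝ fun y => u y t := fun t => (hdx t).differentiable (by norm_num)
  have hreg : RegSol v := by
    refine ⟨?_, ?_, ?_⟩
    · have : Continuous fun p : (Fin N → ℝ) × ℝ => u (p.1 + h) (p.2 + σ) :=
        hcont.comp (show Continuous fun p : (Fin N → ℝ) × ℝ => (p.1 + h, p.2 + σ) by fun_prop)
      exact this.sub hcont
    · intro x
      have : Differentiable ℝ fun s => u (x + h) (s + σ) :=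
        (hdt (x + h)).comp (differentiable_id.add_const σ)
      exact this.sub (hdt x)
    · intro t
      have : ContDiff ℝ 2 fun y => u (y + h) (t + σ) :=
        (hdx (t + σ)).comp (contDiff_id.add contDiff_const)
      exact this.sub (hdx t)
  have heq : AuxEq a b c v := by
    intro x t
    have e0 : deriv (fun s => v x s) t
        = deriv (fun s => u (x + h) s) (t + σ) - deriv (fun s => u x s) t := by
      have h1 : HasDerivAt (fun s => u (x + h) (s + σ)) (deriv (fun s => u (x + h) s) (t + σ)) t :=
        ((hdt (x + h) (t + σ)).hasDerivAt).comp_add_const t σ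
      exact (h1.sub (hdt x t).hasDerivAt).deriv
    have e1 : ∀ i y, pd i (fun y => v y t) y
        = pd i (fun y => u y (t + σ)) (y + h) - pd i (fun y => u y t) y := fun i y =>
      aux_pd_shift i h (hdx1 (t + σ)) (hdx1 t) y
    have e2 : ∀ i j, pd2 i j (fun y => v y t) x
        = pd2 i j (fun y => u y (t + σ)) (x + h) - pd2 i j (fun y => u y t) x := by
      intro i j
      unfold pd2
      simp only [e1]
      exact aux_pd_shift i h (aux_pd_diff (hdx (t + σ)) j) (aux_pd_diff (hdx t) j) x
    have q1 := hequ (x + h) (t + σ)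
    have q2 := hequ x t
    rw [hfp, ← q2] at q1
    simp only [parOp, hap, hbp, hcp] at q1
    rw [e0]
    simp only [e1, e2, mul_sub, Finset.sum_sub_distrib]
    have : c x t * v x t = c x t * u (x + h) (t + σ) - c x t * u x t := by
      simp only [hv]; ring
    rw [this]
    linarith
  have hvK : ∀ x t, |v x t| ≤ 2 * M := by
    intro x t
    have h1 := abs_le.1 (hM (x + h) (t + σ))
    have h2 := abs_le.1 (hM x t)
    simp only [hv]
    rw [abs_le]; constructor <;> linarith
  by_contra hcon
  push Not at hcon
  have hbddA : BddAbove (Set.range fun p : (Fin N → ℝ) × ℝ => v p.1 p.2) := by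
    refine ⟨2 * M, ?_⟩
    rintro _ ⟨p, rfl⟩
    exact (abs_le.1 (hvK p.1 p.2)).2
  set k := sSup (Set.range fun p : (Fin N → ℝ) × ℝ => v p.1 p.2) with hk
  have hvk : ∀ x t, v x t ≤ k := fun x t => le_csSup hbddA ⟨(x, t), rfl⟩
  have hk0 : 0 < k := by
    have h1 := hvk x t
    simp only [hv] at h1
    linarith
  obtain ⟨X, -, hXlim, hXmem⟩ := exists_seq_tendsto_sSup
    (⟨_, ⟨(x, t), rfl⟩⟩ : (Set.range fun p : (Fin N → ℝ) × ℝ => v p.1 p.2).Nonempty) hbddA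
  choose p hp using hXmem
  -- uniform constants
  choose Ma hMa using hab
  choose Mb hMb using hbb
  have hT : ∀ x t, ∑ i, a i i x t ≤ ∑ i, Ma i i := fun x t =>
    Finset.sum_le_sum fun i _ => (le_abs_self _).trans (hMa i i x t)
  have hBb : ∀ i x t, |b i x t| ≤ ∑ i, |Mb i| := fun i x t =>
    ((hMb i x t).trans (le_abs_self _)).trans
      (Finset.single_le_sum (f := fun i => |Mb i|) (fun i _ => abs_nonneg _) (Finset.mem_univ i))
  have hBb0 : 0 ≤ ∑ i, |Mb i| := Finset.sum_nonneg fun i _ => abs_nonneg _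
  have hell' := fun x t ξ => (hell x t ξ).1
  have hG : ∀ x t, |c x t * v x t| ≤ C * (2 * M) := fun x t => by
    rw [abs_mul]
    exact mul_le_mul (hC x t) (hvK x t) (abs_nonneg _) hC0
  have huc : ∀ ω > 0, ∃ r > 0, ∀ (x y : Fin N → ℝ) t, (∀ i, |x i - y i| ≤ r) →
      ∀ i j, |a i j y t - a i j x t| ≤ ω := by
    intro ω hω
    have h1 : UniformContinuous fun (p : (Fin N → ℝ) × ℝ) (i j : Fin N) => a i j p.1 p.2 :=
      uniformContinuous_pi.2 fun i => uniformContinuous_pi.2 fun j => hauc i j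
    obtain ⟨δ, hδ, hδ'⟩ := Metric.uniformContinuous_iff.1 h1 ω hω
    refine ⟨δ / 2, by positivity, fun x y t hxy i j => ?_⟩
    have h2 : dist (y, t) (x, t) < δ := by
      rw [Prod.dist_eq, dist_self]
      refine max_lt ?_ hδ
      refine lt_of_le_of_lt ((dist_pi_le_iff (by positivity)).2 fun i => ?_) (half_lt_self hδ)
      rw [dist_comm, Real.dist_eq]
      exact hxy i
    have h3 := hδ' h2
    have h4 := (dist_pi_lt_iff hω).1 ((dist_pi_lt_iff hω).1 h3 i) j
    rw [Real.dist_eq] at h4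
    exact h4.le
  obtain ⟨L, hL, hhol⟩ := aux_holder hreg heq ha0 hsym hell' hT hBb hBb0 hG
    (by positivity : 0 ≤ 2 * M) hvK huc
  -- propagation of the supremum to earlier times
  have hprop : ∀ (y : Fin N → ℝ) (τ : ℝ), 0 < τ →
      Tendsto (fun n => v ((p n).1 - y) ((p n).2 - τ)) atTop (𝓝 k) := by
    intro y τ hτ
    rw [tendsto_order]
    refine ⟨fun k' hk' => ?_, fun k' hk' => Eventually.of_forall fun n => (hvk _ _).trans_lt hk'⟩
    set ε := (k - k') / 2 with hε
    have hε0 : 0 < ε := by rw [hε]; linarith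
    set r := (ε / L) ^ 2 with hr
    have hr0 : 0 < r := by positivity
    obtain ⟨δ, hδ, hbar⟩ := aux_barrier hreg heq (C := C) ha0 hsym hell' hT hBb hBb0
      (fun x t => (abs_le.1 (hC x t)).1) hc hk0.le hvk hr0 hε0 hτ y
    have hev : ∀ᶠ n in atTop, k - δ < X n := hXlim.eventually (lt_mem_nhds (by linarith))
    filter_upwards [hev] with n hn
    by_contra hle
    push Not at hle
    have h1 := hbar ((p n).1 - y) ((p n).2 - τ) (by
      intro x' hx'
      have h2 := hhol x' ((p n).1 - y) ((p n).2 - τ)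
      have h3 : (∑ i, (x' i - ((p n).1 - y) i) ^ 2) ^ (1 / 4 : ℝ) ≤ (r ^ 2) ^ (1 / 4 : ℝ) :=
        Real.rpow_le_rpow (Finset.sum_nonneg fun i _ => sq_nonneg _) hx' (by norm_num)
      have h4 : (r ^ 2) ^ (1 / 4 : ℝ) = ε / L := by
        rw [hr, ← pow_mul, ← Real.rpow_natCast, ← Real.rpow_mul (by positivity)]
        norm_num
      have h5 : L * (∑ i, (x' i - ((p n).1 - y) i) ^ 2) ^ (1 / 4 : ℝ) ≤ ε := by
        calc _ ≤ L * (ε / L) := by rw [← h4]; gcongr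
          _ = ε := by field_simp
      linarith)
    rw [sub_add_cancel, sub_add_cancel] at h1
    have h6 := hp n
    simp only at h6
    linarith
  -- telescoping
  have htel : ∀ J : ℕ, (J : ℝ) * k ≤ 2 * M := by
    intro J
    set τ := J * |σ| + 1 with hτ
    have hlim : Tendsto (fun n => ∑ i ∈ Finset.range J,
        v ((p n).1 - (-((i:ℝ) • h))) ((p n).2 - (τ - i * σ))) atTop
        (𝓝 (∑ i ∈ Finset.range J, k)) := by
      refine tendsto_finsetSum _ fun i hi => hprop _ _ ?_
      have h1 : (i : ℝ) ≤ J := by exact_mod_cast (Finset.mem_range.1 hi).le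
      have h2 : (i : ℝ) * σ ≤ i * |σ| := by gcongr; exact le_abs_self σ
      have h3 : (i : ℝ) * |σ| ≤ J * |σ| := by gcongr
      linarith
    rw [Finset.sum_const, Finset.card_range, nsmul_eq_mul] at hlim
    refine le_of_tendsto hlim (Eventually.of_forall fun n => ?_)
    have hsum : ∑ i ∈ Finset.range J,
        v ((p n).1 - (-((i:ℝ) • h))) ((p n).2 - (τ - i * σ))
        = ∑ i ∈ Finset.range J, (u ((p n).1 + (((i + 1 : ℕ) : ℝ) • h)) ((p n).2 - τ + ((i + 1 : ℕ) : ℝ) * σ)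
          - u ((p n).1 + ((i:ℝ) • h)) ((p n).2 - τ + i * σ)) := by
      refine Finset.sum_congr rfl fun i _ => ?_
      simp only [hv]
      congr 2
      · push_cast; rw [add_smul, one_smul, sub_neg_eq_add, add_assoc]
      · push_cast; ring
      · rw [sub_neg_eq_add]
      · ring
    rw [hsum, Finset.sum_range_sub
      (fun i : ℕ => u ((p n).1 + ((i:ℝ) • h)) ((p n).2 - τ + i * σ))]
    have h1 := abs_le.1 (hM ((p n).1 + ((J:ℝ) • h)) ((p n).2 - τ + J * σ))
    have h2 := abs_le.1 (hM ((p n).1 + (((0:ℕ):ℝ) • h)) ((p n).2 - τ + (0:ℕ) * σ))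
    linarith
  obtain ⟨J, hJ⟩ := exists_nat_gt (2 * M / k)
  rw [div_lt_iff₀ hk0] at hJ
  exact absurd (htel J) (not_le.2 hJ)

lemma aux_eq {N : ℕ} {a : Fin N → Fin N → (Fin N → ℝ) → ℝ → ℝ}
    {b : Fin N → (Fin N → ℝ) → ℝ → ℝ} {c f u : (Fin N → ℝ) → ℝ → ℝ}
    (hstd : StdCoeffs a b c) (hc : ∀ x t, c x t ≤ 0) (h : Fin N → ℝ) (σ : ℝ)
    (hap : ∀ i j x t, a i j (x + h) (t + σ) = a i j x t)
    (hbp : ∀ i x t, b i (x + h) (t + σ) = b i x t)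
    (hcp : ∀ x t, c (x + h) (t + σ) = c x t) (hfp : ∀ x t, f (x + h) (t + σ) = f x t)
    (hsol : IsSol a b c f u) (hbdd : Bdd2 u) (x : Fin N → ℝ) (t : ℝ) :
    u (x + h) (t + σ) = u x t := by
  refine le_antisymm (aux_main hstd hc h σ hap hbp hcp hfp hsol hbdd x t) ?_
  have hneg : ∀ φ : (Fin N → ℝ) → ℝ → ℝ, (∀ x t, φ (x + h) (t + σ) = φ x t) →
      ∀ x t, φ (x + -h) (t + -σ) = φ x t := by
    intro φ hφ x t
    have := hφ (x + -h) (t + -σ)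
    rw [neg_add_cancel_right, neg_add_cancel_right] at this
    exact this.symm
  have := aux_main hstd hc (-h) (-σ) (fun i j => hneg _ (hap i j)) (fun i => hneg _ (hbp i))
    (hneg _ hcp) (hneg _ hfp) hsol hbdd (x + h) (t + σ)
  rwa [add_neg_cancel_right, add_neg_cancel_right] at this

/-- **Theorem 1.1 (periodicity in one variable).** Let `u` be a bounded solution of
`P u = f` on `ℝ^N × ℝ`, where the operator `P` and the function `f` are periodic in
the `m`-th variable with the same period `l`, and the zero-order coefficient
satisfies `c ≤ 0`.  Then `u` is periodic in the `m`-th variable with period `l`. -/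
theorem periodicity_in_one_variable {N : ℕ}
    (a : Fin N → Fin N → (Fin N → ℝ) → ℝ → ℝ)
    (b : Fin N → (Fin N → ℝ) → ℝ → ℝ) (c : (Fin N → ℝ) → ℝ → ℝ)
    (f u : (Fin N → ℝ) → ℝ → ℝ) (m : Fin (N + 1)) (l : ℝ)
    (hl : 0 < l)
    (hstd : StdCoeffs a b c)
    (hc : ∀ x t, c x t ≤ 0)
    (haper : ∀ i j, PerInVar m l (a i j))
    (hbper : ∀ i, PerInVar m l (b i))
    (hcper : PerInVar m l c)
    (hfper : PerInVar m l f)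
    (hsol : IsSol a b c f u)
    (hbdd : Bdd2 u) :
    PerInVar m l u := by
  unfold PerInVar at haper hbper hcper hfper ⊢
  by_cases hm : (m : ℕ) < N
  · simp only [hm, dif_pos] at haper hbper hcper hfper ⊢
    intro x t
    have := aux_eq hstd hc (Pi.single (⟨(m : ℕ), hm⟩ : Fin N) l) 0
      (fun i j x t => by rw [add_zero]; exact haper i j x t)
      (fun i x t => by rw [add_zero]; exact hbper i x t)
      (fun x t => by rw [add_zero]; exact hcper x t)
      (fun x t => by rw [add_zero]; exact hfper x t) hsol hbdd x t
    rwa [add_zero] at this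
  · simp only [hm, dif_neg, not_false_eq_true] at haper hbper hcper hfper ⊢
    intro x t
    have := aux_eq hstd hc 0 l
      (fun i j x t => by rw [add_zero]; exact haper i j x t)
      (fun i x t => by rw [add_zero]; exact hbper i x t)
      (fun x t => by rw [add_zero]; exact hcper x t)
      (fun x t => by rw [add_zero]; exact hfper x t) hsol hbdd x t
    rwa [add_zero] at this
end
end

section
/- Let u be a bounded solution of Pu = 0 on ℝ^N × ℝ, where the operator P is periodic (in all N+1 variables, with the same period for all coefficients) and c ≤ 0. Then exactly one of the following holds: (1) c ≡ 0 and u is constant; (2) c ≢ 0 and u ≡ 0. In particular, the space of bounded entire solutions has dimension at most one. -/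
open Filter Topology

noncomputable section

/-- Full space-time periodicity with space periods `l i` and time period `τ`. -/
def PerAll {N : ℕ} (l : Fin N → ℝ) (τ : ℝ) (φ : (Fin N → ℝ) → ℝ → ℝ) : Prop :=
  (∀ (i : Fin N) (x : Fin N → ℝ) (t : ℝ), φ (x + Pi.single i (l i)) t = φ x t) ∧
  (∀ (x : Fin N → ℝ) (t : ℝ), φ x (t + τ) = φ x t)

/-! ### Elementary tools -/

/-- Squared Euclidean length. -/
def qf {N : ℕ} (z : Fin N → ℝ) : ℝ := ∑ i, z i ^ 2

/-- Euclidean dot product. -/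
def dt {N : ℕ} (z d : Fin N → ℝ) : ℝ := ∑ i, z i * d i

lemma qf_nonneg {N : ℕ} (z : Fin N → ℝ) : 0 ≤ qf z :=
  Finset.sum_nonneg fun i _ => sq_nonneg _

lemma qf_line {N : ℕ} (z d : Fin N → ℝ) (s : ℝ) :
    qf (z + s • d) = qf z + 2 * dt z d * s + qf d * s ^ 2 := by
  simp only [qf, dt, Finset.mul_sum, Finset.sum_mul, ← Finset.sum_add_distrib, Pi.add_apply,
    Pi.smul_apply, smul_eq_mul]
  exact Finset.sum_congr rfl fun _ _ => by ring

lemma sq_le_qf {N : ℕ} (z : Fin N → ℝ) (i : Fin N) : z i ^ 2 ≤ qf z :=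
  Finset.single_le_sum (f := fun i => z i ^ 2) (fun i _ => sq_nonneg _) (Finset.mem_univ i)

lemma qf_cont {N : ℕ} : Continuous (qf : (Fin N → ℝ) → ℝ) := by
  unfold qf; fun_prop

lemma qf_smul {N : ℕ} (z : Fin N → ℝ) (s : ℝ) : qf (s • z) = s ^ 2 * qf z := by
  simp only [qf, Finset.mul_sum, Pi.smul_apply, smul_eq_mul]
  exact Finset.sum_congr rfl fun _ _ => by ring

lemma qf_pos {N : ℕ} {z : Fin N → ℝ} (h : z ≠ 0) : 0 < qf z := by
  obtain ⟨i, hi⟩ := Function.ne_iff.mp h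
  exact lt_of_lt_of_le (by simpa using sq_pos_of_ne_zero hi) (sq_le_qf z i)

lemma second_deriv_test {h h' : ℝ → ℝ} {m : ℝ}
    (h1 : ∀ᶠ s in 𝓝 (0 : ℝ), HasDerivAt h (h' s) s) (h2 : HasDerivAt h' m 0)
    (hmax : IsLocalMax h 0) : m ≤ 0 := by
  by_contra hm
  push Not at hm
  have hd : deriv h =ᶠ[𝓝 0] h' := h1.mono fun s hs => hs.deriv
  have hdd : deriv (deriv h) 0 = m := by rw [hd.deriv_eq, h2.deriv]
  have hmin := isLocalMin_of_deriv_deriv_pos (by rw [hdd]; exact hm) hmax.deriv_eq_zero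
    h1.self_of_nhds.continuousAt
  have hc : h =ᶠ[𝓝 0] fun _ => h 0 := by
    filter_upwards [hmin, hmax] with s a b using le_antisymm b a
  have : deriv h =ᶠ[𝓝 0] fun _ => 0 := by
    have := hc.deriv
    simpa using this
  have := this.deriv_eq
  rw [hdd] at this
  simp at this
  linarith

lemma left_deriv_nonneg {f : ℝ → ℝ} {d t : ℝ} (h : HasDerivAt f d t)
    (hm : ∀ᶠ s in 𝓝[<] t, f s ≤ f t) : 0 ≤ d := by
  have h1 := (hasDerivAt_iff_tendsto_slope.mp h).mono_left
    (nhdsWithin_mono t (show Set.Iio t ⊆ {t}ᶜ from fun x hx => ne_of_lt hx))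
  refine ge_of_tendsto h1 ?_
  filter_upwards [hm, self_mem_nhdsWithin] with s hs hs'
  rw [slope_def_field]
  exact div_nonneg_of_nonpos (by linarith) (by linarith [Set.mem_Iio.mp hs'])

lemma line_hasDerivAt {N : ℕ} (x ξ : Fin N → ℝ) (s : ℝ) :
    HasDerivAt (fun s : ℝ => x + s • ξ) ξ s := by
  simpa using ((hasDerivAt_id s).smul_const ξ).const_add x

lemma fderiv_eq_sum {N : ℕ} (φ : (Fin N → ℝ) → ℝ) (x ξ : Fin N → ℝ) :
    fderiv ℝ φ x ξ = ∑ i, ξ i * pd i φ x := by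
  conv_lhs => rw [pi_eq_sum_univ' ξ]
  simp [pd, map_sum]

lemma line_deriv {N : ℕ} {φ : (Fin N → ℝ) → ℝ} (hφ : Differentiable ℝ φ)
    (x ξ : Fin N → ℝ) (s : ℝ) :
    HasDerivAt (fun s : ℝ => φ (x + s • ξ)) (∑ i, ξ i * pd i φ (x + s • ξ)) s := by
  rw [← fderiv_eq_sum]
  exact (hφ (x + s • ξ)).hasFDerivAt.comp_hasDerivAt s (line_hasDerivAt x ξ s)

lemma pd_diff {N : ℕ} {φ : (Fin N → ℝ) → ℝ} (hφ : ContDiff ℝ 2 φ) (j : Fin N) :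
    Differentiable ℝ (fun y => pd j φ y) := by
  have : ContDiff ℝ 1 (fderiv ℝ φ) := hφ.fderiv_right (by norm_num)
  have h := this.differentiable (by norm_num)
  unfold pd
  fun_prop

lemma line_deriv2 {N : ℕ} {φ : (Fin N → ℝ) → ℝ} (hφ : ContDiff ℝ 2 φ)
    (x ξ : Fin N → ℝ) :
    HasDerivAt (fun s : ℝ => ∑ j, ξ j * pd j φ (x + s • ξ))
      (∑ i, ∑ j, ξ i * ξ j * pd2 i j φ x) 0 := by
  rw [Finset.sum_comm]
  refine HasDerivAt.fun_sum fun j _ => ?_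
  have h := (line_deriv (pd_diff hφ j) x ξ 0).const_mul (ξ j)
  refine h.congr_deriv ?_
  rw [Finset.mul_sum]
  refine Finset.sum_congr rfl fun i _ => ?_
  simp [pd2]; ring

open scoped MatrixOrder Matrix.Norms.L2Operator in
lemma trace_nonpos {N : ℕ} {A H : Fin N → Fin N → ℝ} (hs : ∀ i j, A i j = A j i)
    (hA : ∀ ξ : Fin N → ℝ, 0 ≤ ∑ i, ∑ j, A i j * ξ i * ξ j)
    (hH : ∀ ξ : Fin N → ℝ, ∑ i, ∑ j, ξ i * ξ j * H i j ≤ 0) :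
    ∑ i, ∑ j, A i j * H i j ≤ 0 := by
  have hp : (Matrix.of A).PosSemidef := by
    refine Matrix.PosSemidef.of_dotProduct_mulVec_nonneg ?_ ?_
    · exact Matrix.IsHermitian.ext fun i j => by simp [hs i j]
    · intro ξ
      refine (hA ξ).trans_eq ?_
      simp only [dotProduct, Matrix.mulVec, Finset.mul_sum, Matrix.of_apply, star_trivial,
        Pi.star_apply]
      exact Finset.sum_congr rfl fun i _ => Finset.sum_congr rfl fun j _ => by ring
  obtain ⟨B, hB⟩ := (CStarAlgebra.nonneg_iff_eq_star_mul_self (a := Matrix.of A)).mp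
    (Matrix.nonneg_iff_posSemidef.mpr hp)
  have hij : ∀ i j, A i j = ∑ k, B k i * B k j := by
    intro i j
    have := congrFun (congrFun hB i) j
    simpa [Matrix.mul_apply, Matrix.star_eq_conjTranspose] using this
  calc ∑ i, ∑ j, A i j * H i j = ∑ k, ∑ i, ∑ j, B k i * B k j * H i j := by
        simp only [hij, Finset.sum_mul]
        rw [Finset.sum_comm]
        conv_rhs => rw [Finset.sum_comm]
        rw [Finset.sum_comm]
        exact Finset.sum_congr rfl fun i _ => Finset.sum_comm
    _ ≤ 0 := Finset.sum_nonpos fun k _ => hH (B k)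

lemma quarter_deriv (L α β γ : ℝ) (hα : 0 < α) :
    (∀ᶠ s in 𝓝 (0 : ℝ), HasDerivAt (fun s : ℝ => L * (α + 2 * β * s + γ * s ^ 2) ^ (1 / 4 : ℝ))
      (L * ((2 * β + 2 * γ * s) * (1 / 4) * (α + 2 * β * s + γ * s ^ 2) ^ (-3 / 4 : ℝ))) s) ∧
    HasDerivAt (fun s : ℝ =>
      L * ((2 * β + 2 * γ * s) * (1 / 4) * (α + 2 * β * s + γ * s ^ 2) ^ (-3 / 4 : ℝ)))
      (L / 2 * α ^ (-3 / 4 : ℝ) * γ - 3 / 2 * (L / 2 * α ^ (-3 / 4 : ℝ)) / α * β ^ 2) 0 := by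
  have hQ : ∀ s : ℝ, HasDerivAt (fun s : ℝ => α + 2 * β * s + γ * s ^ 2) (2 * β + 2 * γ * s) s := by
    intro s
    have h := (((hasDerivAt_id s).const_mul (2 * β)).const_add α).add
      (((hasDerivAt_id s).pow 2).const_mul γ)
    refine h.congr_deriv ?_
    simp; ring
  constructor
  · have hc : ContinuousAt (fun s : ℝ => α + 2 * β * s + γ * s ^ 2) 0 := (hQ 0).continuousAt
    have : ∀ᶠ s in 𝓝 (0 : ℝ), 0 < α + 2 * β * s + γ * s ^ 2 :=
      hc.eventually (lt_mem_nhds (by simpa using hα))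
    filter_upwards [this] with s hs
    have := ((hQ s).rpow_const (p := 1 / 4) (Or.inl hs.ne')).const_mul L
    refine this.congr_deriv ?_
    norm_num
  · have h1 := (hQ 0).rpow_const (p := -3 / 4) (Or.inl (by simpa using hα.ne'))
    have h2 : HasDerivAt (fun s : ℝ => (2 * β + 2 * γ * s) * (1 / 4)) (2 * γ * (1 / 4)) 0 := by
      have := (((hasDerivAt_id (0 : ℝ)).const_mul (2 * γ)).const_add (2 * β)).mul_const (1 / 4)
      simpa using this
    have h3 := (h2.mul h1).const_mul L
    refine h3.congr_deriv ?_
    have : α ^ (-3 / 4 - 1 : ℝ) = α ^ (-3 / 4 : ℝ) / α := by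
      rw [Real.rpow_sub hα, Real.rpow_one]
    simp [this]
    field_simp
    ring

/-! ### The barrier (quantitative strong maximum principle) -/

lemma dt_single {N : ℕ} (z : Fin N → ℝ) (i : Fin N) : dt z (Pi.single i 1) = z i := by
  simp [dt, Pi.single_apply]

lemma sum_single_pd {N : ℕ} (g : Fin N → ℝ) (i : Fin N) :
    ∑ k, (Pi.single i 1 : Fin N → ℝ) k * g k = g i := by
  simp [Pi.single_apply]

lemma abs_le_of_qf {N : ℕ} {z : Fin N → ℝ} {r : ℝ} (hr : 0 ≤ r) (h : qf z ≤ r ^ 2) (i : Fin N) :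
    |z i| ≤ r := abs_le_of_sq_le_sq ((sq_le_qf z i).trans h) hr

lemma qf_ball_compact {N : ℕ} {r : ℝ} (hr : 0 ≤ r) :
    IsCompact {z : Fin N → ℝ | qf z ≤ r ^ 2} := by
  refine (isCompact_closedBall (0 : Fin N → ℝ) r).of_isClosed_subset
    (isClosed_le qf_cont continuous_const) fun z hz => ?_
  rw [mem_closedBall_zero_iff, pi_norm_le_iff_of_nonneg hr]
  exact fun i => abs_le_of_qf hr hz i

/-- Information at an interior maximum in `x` of `v - M + E (r² - |x - y|²)²`. -/
lemma barrier_space {N : ℕ} {φ : (Fin N → ℝ) → ℝ} (hφ : ContDiff ℝ 2 φ) (x y : Fin N → ℝ)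
    (E R : ℝ) (hmax : IsLocalMax (fun x' => φ x' + E * (R - qf (x' - y)) ^ 2) x) :
    (∀ i, pd i φ x = 4 * E * (R - qf (x - y)) * (x - y) i) ∧
    ∀ ξ : Fin N → ℝ, ∑ i, ∑ j, ξ i * ξ j * pd2 i j φ x
      ≤ - (E * (8 * dt (x - y) ξ ^ 2 - 4 * (R - qf (x - y)) * qf ξ)) := by
  set z := x - y with hz
  have hline : ∀ ξ : Fin N → ℝ, IsLocalMax (fun s : ℝ => φ (x + s • ξ) +
      E * (R - (qf z + 2 * dt z ξ * s + qf ξ * s ^ 2)) ^ 2) 0 := by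
    intro ξ
    have hc : ContinuousAt (fun s : ℝ => x + s • ξ) 0 := (line_hasDerivAt x ξ 0).continuousAt
    have hc' : Tendsto (fun s : ℝ => x + s • ξ) (𝓝 0) (𝓝 x) := by
      simpa [ContinuousAt] using hc
    filter_upwards [hc'.eventually hmax] with s hs
    have h2 : qf (x + s • ξ - y) = qf z + 2 * dt z ξ * s + qf ξ * s ^ 2 := by
      rw [← qf_line, show x + s • ξ - y = z + s • ξ by rw [hz]; abel]
    rw [h2] at hs
    simpa using hs
  have hd1 : ∀ (ξ : Fin N → ℝ) (s : ℝ), HasDerivAt (fun s : ℝ => φ (x + s • ξ) +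
      E * (R - (qf z + 2 * dt z ξ * s + qf ξ * s ^ 2)) ^ 2)
      (∑ i, ξ i * pd i φ (x + s • ξ) + E * (2 * (R - (qf z + 2 * dt z ξ * s + qf ξ * s ^ 2)) *
        (-(2 * dt z ξ + 2 * qf ξ * s)))) s := by
    intro ξ s
    refine (line_deriv (hφ.differentiable (by norm_num)) x ξ s).add ?_
    have h := (((((hasDerivAt_id s).const_mul (2 * dt z ξ)).const_add (qf z)).add
      (((hasDerivAt_id s).pow 2).const_mul (qf ξ))).const_sub R).pow 2
    refine (h.const_mul E).congr_deriv ?_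
    simp; ring_nf; simp
  have hd2 : ∀ ξ : Fin N → ℝ, HasDerivAt (fun s : ℝ => ∑ i, ξ i * pd i φ (x + s • ξ) +
      E * (2 * (R - (qf z + 2 * dt z ξ * s + qf ξ * s ^ 2)) *
        (-(2 * dt z ξ + 2 * qf ξ * s))))
      (∑ i, ∑ j, ξ i * ξ j * pd2 i j φ x + E * (8 * dt z ξ ^ 2 - 4 * (R - qf z) * qf ξ)) 0 := by
    intro ξ
    refine (line_deriv2 hφ x ξ).add ?_
    have h := ((((((hasDerivAt_id (0 : ℝ)).const_mul (2 * dt z ξ)).const_add (qf z)).add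
      (((hasDerivAt_id (0 : ℝ)).pow 2).const_mul (qf ξ))).const_sub R).const_mul 2).mul
      (((hasDerivAt_id (0 : ℝ)).const_mul (2 * qf ξ)).const_add (2 * dt z ξ)).neg
    refine (h.const_mul E).congr_deriv ?_
    simp; ring_nf; simp
  constructor
  · intro i
    have := (hline (Pi.single i 1)).hasDerivAt_eq_zero (hd1 (Pi.single i 1) 0)
    rw [dt_single, zero_smul, add_zero, sum_single_pd (fun k => pd k φ x)] at this
    linarith
  · intro ξ
    have := second_deriv_test (Eventually.of_forall (hd1 ξ)) (hd2 ξ) (hline ξ)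
    linarith

set_option maxHeartbeats 1000000 in
lemma barrier {N : ℕ} {a : Fin N → Fin N → (Fin N → ℝ) → ℝ → ℝ}
    {b : Fin N → (Fin N → ℝ) → ℝ → ℝ} {c : (Fin N → ℝ) → ℝ → ℝ}
    {v : (Fin N → ℝ) → ℝ → ℝ} {a₀ B : ℝ} (ha₀ : 0 < a₀) (hB : 0 ≤ B)
    (hsym : ∀ i j x t, a i j x t = a j i x t)
    (hell : ∀ (x : Fin N → ℝ) (t : ℝ) (ξ : Fin N → ℝ),
      a₀ * qf ξ ≤ ∑ i, ∑ j, a i j x t * ξ i * ξ j)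
    (hA : ∀ i j x t, |a i j x t| ≤ B) (hb : ∀ i x t, |b i x t| ≤ B)
    (hc : ∀ x t, c x t ≤ 0) (hsol : IsSol a b c (fun _ _ => 0) v)
    {M δ r D T₀ T₁ : ℝ} (hM : ∀ x t, v x t ≤ M) (hδ : 0 < δ) (hδM : δ ≤ M) (hr : 0 < r)
    (hD : 0 ≤ D) (hT₀ : 0 < T₀) :
    ∃ η > 0, ∀ x₀ t₀ x₁ T, T₀ ≤ T → T ≤ T₁ → (∀ i, |x₀ i - x₁ i| ≤ D) →
      (∀ x, qf (x - x₁) ≤ r ^ 2 → v x (t₀ - T) ≤ M - δ) → v x₀ t₀ ≤ M - η := by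
  obtain ⟨⟨hcont, hdt, hdx⟩, heq⟩ := hsol
  set P := D / T₀ with hP
  have hP0 : 0 ≤ P := by positivity
  set C := 4 * (N * (r * (P + B))) + 4 * (N * B) + 8 * a₀ with hC
  have hC0 : 0 < C := by positivity
  set κ := C ^ 2 / (16 * a₀ * r ^ 2) with hκ
  have hκ0 : 0 < κ := by positivity
  refine ⟨δ * Real.exp (-κ * T₁), by positivity, ?_⟩
  intro x₀ t₀ x₁ T hT0 hT1 hx hinit
  have hT : 0 < T := hT₀.trans_le hT0
  by_contra hcon
  push Not at hcon
  set t₁ := t₀ - T with ht₁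
  set p : Fin N → ℝ := T⁻¹ • (x₀ - x₁) with hp
  have hpP : ∀ i, |p i| ≤ P := by
    intro i
    simp only [hp, Pi.smul_apply, Pi.sub_apply, smul_eq_mul, abs_mul, abs_inv, abs_of_pos hT]
    rw [hP, div_eq_inv_mul]
    have : T⁻¹ ≤ T₀⁻¹ := inv_anti₀ hT₀ hT0
    exact mul_le_mul this (hx i) (abs_nonneg _) (by positivity)
  set y : ℝ → Fin N → ℝ := fun t => x₁ + (t - t₁) • p with hy
  set e : ℝ → ℝ := fun t => δ / r ^ 4 * Real.exp (-κ * (t - t₁)) with he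
  have he0 : ∀ t, 0 < e t := fun t => by simp only [he]; positivity
  set W : (Fin N → ℝ) → ℝ → ℝ := fun x t => v x t + e t * (r ^ 2 - qf (x - y t)) ^ 2 with hW
  have hWc : Continuous fun q : (Fin N → ℝ) × ℝ => W q.1 q.2 := by
    simp only [hW, he, hy]
    have := @qf_cont N
    fun_prop
  have hK : IsCompact ({z : Fin N → ℝ | qf z ≤ r ^ 2} ×ˢ Set.Icc t₁ t₀) :=
    (qf_ball_compact hr.le).prod isCompact_Icc
  have hmemK : ((0 : Fin N → ℝ), t₀) ∈ ({z : Fin N → ℝ | qf z ≤ r ^ 2} ×ˢ Set.Icc t₁ t₀) := by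
    refine ⟨?_, ?_, le_rfl⟩
    · simp [qf]; positivity
    · simp only; linarith
  obtain ⟨⟨z, t⟩, ⟨hzK, htK⟩, hmx⟩ := hK.exists_isMaxOn ⟨_, hmemK⟩
    (f := fun q : (Fin N → ℝ) × ℝ => W (q.1 + y q.2) q.2)
    (by
      apply Continuous.continuousOn
      have h1 : Continuous fun q : (Fin N → ℝ) × ℝ => (q.1 + y q.2, q.2) := by
        simp only [hy]; fun_prop
      exact hWc.comp h1)
  simp only [Set.mem_ofPred_eq] at hzK htK
  have hmx' : ∀ x s, qf (x - y s) ≤ r ^ 2 → t₁ ≤ s → s ≤ t₀ → W x s ≤ W (z + y t) t := by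
    intro x s h1 h2 h3
    have := hmx (show (x - y s, s) ∈ _ from ⟨h1, h2, h3⟩)
    simpa using this
  set x := z + y t with hxdef
  have hxz : x - y t = z := by rw [hxdef]; abel
  have hy0 : y t₀ = x₀ := by
    simp only [hy, hp, ht₁, smul_smul]
    rw [show t₀ - (t₀ - T) = T by ring, mul_inv_cancel₀ hT.ne', one_smul]; abel
  have hpos : M < W x t := by
    have h1 := hmx' x₀ t₀ (by rw [hy0]; simp [qf]; positivity) (by linarith) le_rfl
    refine lt_of_lt_of_le ?_ h1
    simp only [hW, hy0, he]
    have hq0 : qf (x₀ - x₀) = 0 := by simp [qf]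
    rw [hq0, show t₀ - t₁ = T by rw [ht₁]; ring]
    have h2 : Real.exp (-κ * T₁) ≤ Real.exp (-κ * T) := by
      apply Real.exp_le_exp.mpr
      have := mul_le_mul_of_nonneg_left hT1 hκ0.le
      linarith
    have h3 : δ / r ^ 4 * Real.exp (-κ * T) * (r ^ 2 - 0) ^ 2 = δ * Real.exp (-κ * T) := by
      field_simp; ring
    rw [h3]
    have := mul_le_mul_of_nonneg_left h2 hδ.le
    linarith
  set S := r ^ 2 - qf z with hS
  have hS0 : 0 ≤ S := by linarith
  have hWx : W x t = v x t + e t * S ^ 2 := by simp only [hW, hxz, hS]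
  have hSpos : 0 < S := by
    rcases hS0.lt_or_eq with h | h
    · exact h
    · rw [hWx, ← h] at hpos
      have := hM x t
      simp at hpos
      linarith
  have hSr : S ≤ r ^ 2 := by linarith [qf_nonneg z]
  have heS : e t * S ^ 2 ≤ δ := by
    have h1 : e t ≤ δ / r ^ 4 := by
      simp only [he]
      have : Real.exp (-κ * (t - t₁)) ≤ 1 := Real.exp_le_one_iff.mpr (by
        have := mul_nonneg hκ0.le (sub_nonneg.mpr htK.1)
        linarith)
      have h' : 0 < δ / r ^ 4 := by positivity
      exact mul_le_of_le_one_right h'.le this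
    have h2 : S ^ 2 ≤ r ^ 4 := (pow_le_pow_left₀ hS0 hSr 2).trans_eq (by ring)
    calc e t * S ^ 2 ≤ δ / r ^ 4 * r ^ 4 := by gcongr
      _ = δ := by field_simp
  have hvpos : 0 < v x t := by rw [hWx] at hpos; linarith
  have htlt : t₁ < t := by
    rcases htK.1.lt_or_eq with h | h
    · exact h
    · exfalso
      have h1 : y t = x₁ := by simp only [hy, ← h]; simp
      have h2 := hinit x (by rw [← h1, hxz]; exact hzK)
      rw [hWx, ← h] at hpos
      rw [← h] at heS
      linarith
  -- space information
  have hnb : ∀ᶠ x' in 𝓝 x, qf (x' - y t) < r ^ 2 := by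
    have hc1 : ContinuousAt (fun x' => qf (x' - y t)) x :=
      (qf_cont.comp (by fun_prop)).continuousAt
    exact hc1.eventually (gt_mem_nhds (by
      show qf (x - y t) < r ^ 2
      rw [hxz]; linarith))
  have hloc : IsLocalMax (fun x' => v x' t + e t * (r ^ 2 - qf (x' - y t)) ^ 2) x := by
    filter_upwards [hnb] with x' hx'
    exact hmx' x' t hx'.le htK.1 htK.2
  obtain ⟨hgrad, hhess⟩ := barrier_space (hdx t) x (y t) (e t) (r ^ 2) hloc
  rw [hxz] at hgrad hhess
  -- time information
  have htime : 0 ≤ deriv (fun s => v x s) t + e t * (-κ * S ^ 2 + 4 * S * dt z p) := by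
    have hf : (fun s => W x s) = fun s => v x s + e s * (r ^ 2 -
        (qf z + 2 * dt z p * (-(s - t)) + qf p * (-(s - t)) ^ 2)) ^ 2 := by
      funext s
      simp only [hW]
      rw [← qf_line]
      congr 5
      rw [hxdef]; simp only [hy]; module
    have hder : HasDerivAt (fun s => W x s)
        (deriv (fun s => v x s) t + e t * (-κ * S ^ 2 + 4 * S * dt z p)) t := by
      rw [hf]
      have h1 := (hdt x t).hasDerivAt
      have h2 : HasDerivAt e (-κ * e t) t := by
        have := ((((hasDerivAt_id t).sub_const t₁).const_mul (-κ)).exp).const_mul (δ / r ^ 4)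
        refine this.congr_deriv ?_
        simp [he]; ring
      have h3 : HasDerivAt (fun s : ℝ => -(s - t)) (-1) t :=
        ((hasDerivAt_id t).sub_const t).neg
      have h4 := ((((h3.const_mul (2 * dt z p)).const_add (qf z)).add
        ((h3.pow 2).const_mul (qf p))).const_sub (r ^ 2)).pow 2
      refine (h1.add (h2.mul h4)).congr_deriv ?_
      simp [hS]; ring
    refine left_deriv_nonneg hder ?_
    have hc2 : ContinuousAt (fun s => qf (x - y s)) t := by
      refine (qf_cont.comp ?_).continuousAt
      simp only [hy]; fun_prop
    have h5 : ∀ᶠ s in 𝓝 t, qf (x - y s) < r ^ 2 :=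
      hc2.eventually (gt_mem_nhds (by
      show qf (x - y t) < r ^ 2
      rw [hxz]; linarith))
    filter_upwards [h5.filter_mono nhdsWithin_le_nhds, Ico_mem_nhdsLT htlt] with s h6 h7
    exact hmx' x s h6.le h7.1 (h7.2.le.trans htK.2)
  -- trace
  have htr := trace_nonpos (A := fun i j => a i j x t)
    (H := fun i j => pd2 i j (fun y => v y t) x +
      e t * (8 * (z i * z j) - 4 * S * (if i = j then 1 else 0)))
    (fun i j => hsym i j x t)
    (fun ξ => le_trans (mul_nonneg ha₀.le (qf_nonneg ξ)) (hell x t ξ)) (by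
      intro ξ
      have h1 := hhess ξ
      have h2 : ∑ i, ∑ j, ξ i * ξ j * (e t * (8 * (z i * z j) - 4 * S * (if i = j then 1 else 0)))
          = e t * (8 * dt z ξ ^ 2 - 4 * S * qf ξ) := by
        have h3 : dt z ξ ^ 2 = ∑ i, ∑ j, ξ i * ξ j * (z i * z j) := by
          rw [sq, dt, Finset.sum_mul_sum]
          exact Finset.sum_congr rfl fun i _ => Finset.sum_congr rfl fun j _ => by ring
        have h4 : qf ξ = ∑ i, ∑ j, ξ i * ξ j * (if i = j then 1 else 0) := by
          simp [qf, sq]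
        rw [h3, h4]
        simp only [Finset.mul_sum, ← Finset.sum_sub_distrib]
        exact Finset.sum_congr rfl fun i _ => Finset.sum_congr rfl fun j _ => by ring
      simp only [mul_add, Finset.sum_add_distrib]
      rw [h2]
      linarith)
  have htr2 : ∑ i, ∑ j, a i j x t * (e t * (8 * (z i * z j) - 4 * S * (if i = j then 1 else 0)))
      = e t * (8 * ∑ i, ∑ j, a i j x t * z i * z j - 4 * S * ∑ i, a i i x t) := by
    have h4 : ∑ i, a i i x t = ∑ i, ∑ j, a i j x t * (if i = j then 1 else 0) := by
      simp
    rw [h4]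
    simp only [Finset.mul_sum, ← Finset.sum_sub_distrib]
    exact Finset.sum_congr rfl fun i _ => Finset.sum_congr rfl fun j _ => by ring
  simp only [mul_add, Finset.sum_add_distrib] at htr
  rw [htr2] at htr
  have hq := heq x t
  simp only [parOp] at hq
  have hbs : ∑ i, b i x t * pd i (fun y => v y t) x = 4 * e t * S * ∑ i, b i x t * z i := by
    rw [Finset.mul_sum]
    exact Finset.sum_congr rfl fun i _ => by rw [hgrad i]; ring
  rw [hbs] at hq
  have hcv : c x t * v x t ≤ 0 := mul_nonpos_of_nonpos_of_nonneg (hc x t) hvpos.le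
  have hza := hell x t z
  have htrA : ∑ i, a i i x t ≤ N * B := by
    calc ∑ i, a i i x t ≤ ∑ _i : Fin N, B :=
          Finset.sum_le_sum fun i _ => (le_abs_self _).trans (hA i i x t)
      _ = N * B := by simp
  have hzb : ∑ i, b i x t * z i + dt z p ≤ N * (r * (P + B)) := by
    rw [dt, ← Finset.sum_add_distrib]
    calc ∑ i, (b i x t * z i + z i * p i) ≤ ∑ _i : Fin N, r * (P + B) := by
          refine Finset.sum_le_sum fun i _ => ?_
          have h1 := abs_le_of_qf hr.le hzK i
          calc b i x t * z i + z i * p i = z i * (p i + b i x t) := by ring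
            _ ≤ |z i * (p i + b i x t)| := le_abs_self _
            _ = |z i| * |p i + b i x t| := abs_mul _ _
            _ ≤ r * (P + B) := mul_le_mul h1
                ((abs_add_le _ _).trans (add_le_add (hpP i) (hb i x t))) (abs_nonneg _) hr.le
      _ = N * (r * (P + B)) := by simp
  have key : 0 ≤ e t * (-κ * S ^ 2 + C * S - 8 * a₀ * r ^ 2) := by
    have h1 : 0 ≤ e t * (-κ * S ^ 2 + 4 * S * (∑ i, b i x t * z i + dt z p)
        - 8 * ∑ i, ∑ j, a i j x t * z i * z j + 4 * S * ∑ i, a i i x t) := by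
      linear_combination htime + hcv + htr + hq
    refine h1.trans (mul_le_mul_of_nonneg_left ?_ (he0 t).le)
    have h2 : S * (∑ i, b i x t * z i + dt z p) ≤ S * (N * (r * (P + B))) :=
      mul_le_mul_of_nonneg_left hzb hS0
    have h3 : S * ∑ i, a i i x t ≤ S * (N * B) := mul_le_mul_of_nonneg_left htrA hS0
    have h4 : qf z = r ^ 2 - S := by rw [hS]; ring
    rw [h4] at hza
    rw [hC]
    nlinarith
  have hneg : -κ * S ^ 2 + C * S - 8 * a₀ * r ^ 2 < 0 := by
    have h1 : 4 * κ * (4 * a₀ * r ^ 2) = C ^ 2 := by rw [hκ]; field_simp; ring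
    have h2 : 0 < a₀ * r ^ 2 := by positivity
    have h3 : 0 ≤ (2 * κ * S - C) ^ 2 := sq_nonneg _
    by_contra h
    push Not at h
    have h5 := mul_nonneg (by positivity : 0 ≤ 4 * κ) h
    have h6 : 0 < κ * (a₀ * r ^ 2) := by positivity
    nlinarith
  have := mul_neg_of_pos_of_neg (he0 t) hneg
  linarith

/-! ### Spatial regularity by doubling of variables (Ishii–Lions) -/

lemma doubling_space {N : ℕ} {φ : (Fin N → ℝ) → ℝ} (hφ : ContDiff ℝ 2 φ) (x y : Fin N → ℝ)
    (L k : ℝ) (hz : 0 < qf (x - y))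
    (hmax : ∀ x' y', φ x' - φ y' - L * qf (x' - y') ^ (1 / 4 : ℝ) - k * qf x' ≤
      φ x - φ y - L * qf (x - y) ^ (1 / 4 : ℝ) - k * qf x) :
    (∀ i, pd i φ x = L / 2 * qf (x - y) ^ (-3 / 4 : ℝ) * (x - y) i + 2 * k * x i) ∧
    (∀ i, pd i φ y = L / 2 * qf (x - y) ^ (-3 / 4 : ℝ) * (x - y) i) ∧
    ∀ ξ η : Fin N → ℝ, ∑ i, ∑ j, ξ i * ξ j * pd2 i j φ x - ∑ i, ∑ j, η i * η j * pd2 i j φ y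
      ≤ L / 2 * qf (x - y) ^ (-3 / 4 : ℝ) * qf (ξ - η)
        - 3 / 2 * (L / 2 * qf (x - y) ^ (-3 / 4 : ℝ)) / qf (x - y) * dt (x - y) (ξ - η) ^ 2
        + 2 * k * qf ξ := by
  set z := x - y with hzdef
  have hline : ∀ ξ η : Fin N → ℝ, IsLocalMax (fun s : ℝ => φ (x + s • ξ) - φ (y + s • η) -
      L * (qf z + 2 * dt z (ξ - η) * s + qf (ξ - η) * s ^ 2) ^ (1 / 4 : ℝ) -
      k * (qf x + 2 * dt x ξ * s + qf ξ * s ^ 2)) 0 := by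
    intro ξ η
    refine Eventually.of_forall fun s => ?_
    have h := hmax (x + s • ξ) (y + s • η)
    rw [show x + s • ξ - (y + s • η) = z + s • (ξ - η) by rw [hzdef]; module, qf_line,
      qf_line] at h
    simpa using h
  have hq := fun ξ η : Fin N → ℝ => quarter_deriv L (qf z) (dt z (ξ - η)) (qf (ξ - η)) hz
  have hd1 : ∀ ξ η : Fin N → ℝ, ∀ᶠ s in 𝓝 (0 : ℝ),
      HasDerivAt (fun s : ℝ => φ (x + s • ξ) - φ (y + s • η) -
      L * (qf z + 2 * dt z (ξ - η) * s + qf (ξ - η) * s ^ 2) ^ (1 / 4 : ℝ) -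
      k * (qf x + 2 * dt x ξ * s + qf ξ * s ^ 2))
      (∑ i, ξ i * pd i φ (x + s • ξ) - ∑ i, η i * pd i φ (y + s • η) -
        L * ((2 * dt z (ξ - η) + 2 * qf (ξ - η) * s) * (1 / 4) *
          (qf z + 2 * dt z (ξ - η) * s + qf (ξ - η) * s ^ 2) ^ (-3 / 4 : ℝ)) -
        k * (2 * dt x ξ + 2 * qf ξ * s)) s := by
    intro ξ η
    filter_upwards [(hq ξ η).1] with s hs
    have h1 := line_deriv (hφ.differentiable (by norm_num)) x ξ s
    have h2 := line_deriv (hφ.differentiable (by norm_num)) y η s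
    have h3 := (((((hasDerivAt_id s).const_mul (2 * dt x ξ)).const_add (qf x)).add
      (((hasDerivAt_id s).pow 2).const_mul (qf ξ)))).const_mul k
    refine (((h1.sub h2).sub hs).sub h3).congr_deriv ?_
    simp; ring_nf; simp
  have hd2 : ∀ ξ η : Fin N → ℝ, HasDerivAt (fun s : ℝ =>
      ∑ i, ξ i * pd i φ (x + s • ξ) - ∑ i, η i * pd i φ (y + s • η) -
        L * ((2 * dt z (ξ - η) + 2 * qf (ξ - η) * s) * (1 / 4) *
          (qf z + 2 * dt z (ξ - η) * s + qf (ξ - η) * s ^ 2) ^ (-3 / 4 : ℝ)) -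
        k * (2 * dt x ξ + 2 * qf ξ * s))
      (∑ i, ∑ j, ξ i * ξ j * pd2 i j φ x - ∑ i, ∑ j, η i * η j * pd2 i j φ y
      - (L / 2 * qf z ^ (-3 / 4 : ℝ) * qf (ξ - η)
        - 3 / 2 * (L / 2 * qf z ^ (-3 / 4 : ℝ)) / qf z * dt z (ξ - η) ^ 2)
        - 2 * k * qf ξ) 0 := by
    intro ξ η
    have h1 := line_deriv2 hφ x ξ
    have h2 := line_deriv2 hφ y η
    have h3 := ((((hasDerivAt_id (0 : ℝ)).const_mul (2 * qf ξ)).const_add (2 * dt x ξ))).const_mul k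
    refine (((h1.sub h2).sub (hq ξ η).2).sub h3).congr_deriv ?_
    simp; ring
  refine ⟨fun i => ?_, fun i => ?_, fun ξ η => ?_⟩
  · have := (hline (Pi.single i 1) 0).hasDerivAt_eq_zero (hd1 (Pi.single i 1) 0).self_of_nhds
    simp only [sub_zero, dt_single, zero_smul, add_zero, sum_single_pd (fun k => pd k φ x),
      Pi.zero_apply, zero_mul, Finset.sum_const_zero, mul_zero, zero_pow two_ne_zero] at this
    norm_num at this ⊢
    linarith
  · have := (hline 0 (-Pi.single i 1)).hasDerivAt_eq_zero (hd1 0 (-Pi.single i 1)).self_of_nhds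
    have h0 : dt x (0 : Fin N → ℝ) = 0 := by simp [dt]
    simp only [sub_neg_eq_add, zero_add, dt_single, zero_smul, add_zero, Pi.neg_apply, neg_mul,
      Finset.sum_neg_distrib, sum_single_pd (fun k => pd k φ y), h0,
      Pi.zero_apply, zero_mul, Finset.sum_const_zero, mul_zero, zero_pow two_ne_zero] at this
    norm_num at this ⊢
    linarith
  · have := second_deriv_test (hd1 ξ η) (hd2 ξ η) (hline ξ η)
    linarith

/-- sums of quadratic forms against the identity -/
lemma sum_id_form {N : ℕ} (ξ : Fin N → ℝ) (m : ℝ) :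
    ∑ i, ∑ j, ξ i * ξ j * (m * (if i = j then 1 else 0)) = m * qf ξ := by
  simp only [qf, Finset.mul_sum]
  refine Finset.sum_congr rfl fun i _ => ?_
  simp; ring

lemma doubling_trace {N : ℕ} {A A' X Y : Fin N → Fin N → ℝ} {z : Fin N → ℝ}
    {a₀ B θ c₁ k : ℝ} (hz : 0 < qf z) (hc₁ : 0 ≤ c₁) (hk : 0 ≤ k) (hθ : 0 ≤ θ)
    (hθa : θ ≤ a₀ / 2)
    (hs : ∀ i j, A i j = A j i) (hs' : ∀ i j, A' i j = A' j i)
    (hell : ∀ ξ : Fin N → ℝ, a₀ * qf ξ ≤ ∑ i, ∑ j, A i j * ξ i * ξ j)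
    (hB : ∀ i j, |A i j| ≤ B) (hE : ∀ i j, N * |A' i j - A i j| ≤ θ)
    (hH : ∀ ξ η : Fin N → ℝ, ∑ i, ∑ j, ξ i * ξ j * X i j - ∑ i, ∑ j, η i * η j * Y i j
      ≤ c₁ * qf (ξ - η) - 3 / 2 * c₁ / qf z * dt z (ξ - η) ^ 2 + 2 * k * qf ξ) :
    ∑ i, ∑ j, A i j * X i j - ∑ i, ∑ j, A' i j * Y i j ≤
      c₁ * (- a₀ + 3 * N * θ) + 2 * k * (N * B + a₀ / 2 + N * θ) := by
  have ha₀ : 0 ≤ a₀ := by linarith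
  have hdd : ∀ i j : Fin N, (if i = j then (1 : ℝ) else 0) = if j = i then 1 else 0 := by
    intro i j; simp [eq_comm]
  have hcoef : 0 ≤ 3 / 2 * c₁ / qf z := by positivity
  have hqz : qf (0 : Fin N → ℝ) = 0 := by simp [qf]
  -- synchronous part
  have e1 := trace_nonpos
    (A := fun i j => A i j - θ * (if i = j then 1 else 0) - a₀ / 2 / qf z * (z i * z j))
    (H := fun i j => X i j - Y i j - 2 * k * (if i = j then 1 else 0))
    (fun i j => by rw [hs i j, hdd i j]; ring)
    (fun ξ => by
      have h1 := hell ξ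
      have h2 : ∑ i, ∑ j, (A i j - θ * (if i = j then 1 else 0)
          - a₀ / 2 / qf z * (z i * z j)) * ξ i * ξ j =
          ∑ i, ∑ j, A i j * ξ i * ξ j - θ * qf ξ - a₀ / 2 / qf z * dt z ξ ^ 2 := by
        rw [← sum_id_form ξ θ, sq (dt z ξ), dt, Finset.sum_mul_sum]
        simp only [Finset.mul_sum, ← Finset.sum_sub_distrib]
        exact Finset.sum_congr rfl fun i _ => Finset.sum_congr rfl fun j _ => by ring
      rw [h2]
      have h3 : dt z ξ ^ 2 ≤ qf z * qf ξ := Finset.sum_mul_sq_le_sq_mul_sq _ _ _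
      have h4 : a₀ / 2 / qf z * dt z ξ ^ 2 ≤ a₀ / 2 * qf ξ := by
        calc a₀ / 2 / qf z * dt z ξ ^ 2 ≤ a₀ / 2 / qf z * (qf z * qf ξ) := by gcongr
          _ = a₀ / 2 * qf ξ := by field_simp
      have h5 := mul_le_mul_of_nonneg_right hθa (qf_nonneg ξ)
      linarith)
    (fun ξ => by
      have h1 := hH ξ ξ
      have h2 := sum_id_form ξ (2 * k)
      have h3 : dt z (ξ - ξ) = 0 := by simp [dt]
      rw [sub_self ξ] at h1 h3
      rw [h3, hqz] at h1
      simp only [mul_sub, Finset.sum_sub_distrib]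
      rw [h2]
      linarith)
  -- reflected part
  have e2 := hH z (-z)
  have e2' : ∑ i, ∑ j, z i * z j * X i j - ∑ i, ∑ j, z i * z j * Y i j ≤
      qf z * (-2 * c₁ + 2 * k) := by
    have h1 : z - -z = (2 : ℝ) • z := by module
    have h2 : dt z ((2 : ℝ) • z) = 2 * qf z := by
      simp only [dt, qf, Finset.mul_sum, Pi.smul_apply, smul_eq_mul]
      exact Finset.sum_congr rfl fun i _ => by ring
    rw [h1, h2, qf_smul] at e2
    have h3 : 3 / 2 * c₁ / qf z * (2 * qf z) ^ 2 = 6 * c₁ * qf z := by field_simp; ring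
    rw [h3] at e2
    simp only [Pi.neg_apply, neg_mul_neg] at e2
    linarith
  -- remaining parts
  have e3 : ∑ i, X i i ≤ N * (c₁ + 2 * k) := by
    calc ∑ i, X i i ≤ ∑ _i : Fin N, (c₁ + 2 * k) := by
          refine Finset.sum_le_sum fun i _ => ?_
          have h := hH (Pi.single i 1) 0
          have h1 : qf (Pi.single i 1 : Fin N → ℝ) = 1 := by simp [qf, Pi.single_apply]
          rw [sub_zero, h1] at h
          have h2 : ∑ k, ∑ j, (Pi.single i 1 : Fin N → ℝ) k * (Pi.single i 1 : Fin N → ℝ) j * X k j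
              = X i i := by simp [Pi.single_apply]
          rw [h2] at h
          have h3 : 0 ≤ 3 / 2 * c₁ / qf z * dt z (Pi.single i 1) ^ 2 := by positivity
          simp only [Pi.zero_apply, zero_mul, Finset.sum_const_zero] at h
          linarith
      _ = N * (c₁ + 2 * k) := by simp; ring
  have e4 := trace_nonpos
    (A := fun i j => θ * (if i = j then 1 else 0) + (A' i j - A i j))
    (H := fun i j => - Y i j - c₁ * (if i = j then 1 else 0))
    (fun i j => by rw [hs i j, hs' i j, hdd i j])
    (fun ξ => by
      have h2 : ∑ i, ∑ j, (θ * (if i = j then 1 else 0) + (A' i j - A i j)) * ξ i * ξ j =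
          θ * qf ξ + ∑ i, ∑ j, (A' i j - A i j) * ξ i * ξ j := by
        rw [← sum_id_form ξ θ]
        simp only [← Finset.sum_add_distrib]
        exact Finset.sum_congr rfl fun i _ => Finset.sum_congr rfl fun j _ => by ring
      rw [h2]
      rcases Nat.eq_zero_or_pos N with hN | hN
      · subst hN; simp [qf]
      have hN' : (0 : ℝ) < N := by exact_mod_cast hN
      have h3 : ∑ i, ∑ j, (-(θ / N) * ((ξ i ^ 2 + ξ j ^ 2) / 2)) ≤
          ∑ i, ∑ j, (A' i j - A i j) * ξ i * ξ j := by
        refine Finset.sum_le_sum fun i _ => Finset.sum_le_sum fun j _ => ?_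
        have h4 : |A' i j - A i j| ≤ θ / N := by
          rw [le_div_iff₀ hN']; linarith [hE i j]
        have h5 : |ξ i * ξ j| ≤ (ξ i ^ 2 + ξ j ^ 2) / 2 := by
          rw [abs_le]; constructor <;> nlinarith [sq_nonneg (ξ i + ξ j), sq_nonneg (ξ i - ξ j)]
        have h6 : |(A' i j - A i j) * (ξ i * ξ j)| ≤ θ / N * ((ξ i ^ 2 + ξ j ^ 2) / 2) := by
          rw [abs_mul]; exact mul_le_mul h4 h5 (abs_nonneg _) (by positivity)
        have := (abs_le.mp h6).1
        linarith
      have h7 : ∑ i : Fin N, ∑ j : Fin N, (-(θ / N) * ((ξ i ^ 2 + ξ j ^ 2) / 2)) = - (θ * qf ξ) := by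
        simp only [← Finset.mul_sum, ← Finset.sum_div, Finset.sum_add_distrib, Finset.sum_const,
          Finset.card_univ, Fintype.card_fin, nsmul_eq_mul]
        simp only [qf]
        field_simp; ring
      linarith)
    (fun ξ => by
      have h1 := hH 0 ξ
      have h2 := sum_id_form ξ c₁
      have h3 : 0 ≤ 3 / 2 * c₁ / qf z * dt z (0 - ξ) ^ 2 := by positivity
      have h4 : qf (0 - ξ) = qf ξ := by simp [qf]
      rw [h4, hqz] at h1
      simp only [Pi.zero_apply, zero_mul, Finset.sum_const_zero] at h1
      simp only [mul_sub, Finset.sum_sub_distrib, mul_neg, Finset.sum_neg_distrib]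
      rw [h2]
      linarith)
  -- expand
  have htrA : ∑ i, A i i ≤ N * B := by
    calc ∑ i, A i i ≤ ∑ _i : Fin N, B :=
          Finset.sum_le_sum fun i _ => (le_abs_self _).trans (hB i i)
      _ = N * B := by simp
  have htrE : ∑ i, (A' i i - A i i) ≤ N * θ := by
    calc ∑ i, (A' i i - A i i) ≤ ∑ _i : Fin N, θ := by
          refine Finset.sum_le_sum fun i _ => (le_abs_self _).trans (le_trans ?_ (hE i i))
          have : (1 : ℝ) ≤ N := by exact_mod_cast (Nat.one_le_iff_ne_zero.mpr (by
            rintro rfl; exact i.elim0))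
          exact le_mul_of_one_le_left (abs_nonneg _) this
      _ = N * θ := by simp
  have hδs : ∀ F : Fin N → Fin N → ℝ, ∑ i, ∑ j, F i j * (if i = j then (1 : ℝ) else 0)
      = ∑ i, F i i := by
    intro F; simp
  have hδ1 : ∑ i : Fin N, ∑ j : Fin N, (if i = j then (1 : ℝ) else 0) = N := by simp
  have hδ2 : ∀ i j : Fin N, (if i = j then (1 : ℝ) else 0) * (if i = j then (1 : ℝ) else 0)
      = if i = j then 1 else 0 := by intro i j; split_ifs <;> simp
  have hzz : ∑ i, z i * z i = qf z := by simp [qf, sq]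
  have x1 : ∑ i, ∑ j, (A i j - θ * (if i = j then 1 else 0) - a₀ / 2 / qf z * (z i * z j)) *
      (X i j - Y i j - 2 * k * (if i = j then 1 else 0)) =
      ∑ i, ∑ j, A i j * X i j - ∑ i, ∑ j, A i j * Y i j - 2 * k * ∑ i, A i i
      - θ * ∑ i, X i i + θ * ∑ i, Y i i + 2 * k * θ * N
      - a₀ / 2 / qf z * (∑ i, ∑ j, z i * z j * X i j - ∑ i, ∑ j, z i * z j * Y i j)
      + a₀ / 2 / qf z * (2 * k) * qf z := by
    rw [← hδ1, ← hzz, ← hδs A, ← hδs X, ← hδs Y, ← hδs (fun i j => z i * z j)]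
    simp only [Finset.mul_sum, ← Finset.sum_sub_distrib, ← Finset.sum_add_distrib]
    exact Finset.sum_congr rfl fun i _ => Finset.sum_congr rfl fun j _ => by
      linear_combination 2 * k * θ * hδ2 i j
  have x4 : ∑ i, ∑ j, (θ * (if i = j then 1 else 0) + (A' i j - A i j)) *
      (- Y i j - c₁ * (if i = j then 1 else 0)) =
      - θ * ∑ i, Y i i - c₁ * θ * N - ∑ i, ∑ j, A' i j * Y i j + ∑ i, ∑ j, A i j * Y i j
      - c₁ * ∑ i, (A' i i - A i i) := by
    rw [← hδ1, ← hδs Y, ← hδs (fun i j => A' i j - A i j)]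
    simp only [Finset.mul_sum, ← Finset.sum_sub_distrib, ← Finset.sum_add_distrib]
    exact Finset.sum_congr rfl fun i _ => Finset.sum_congr rfl fun j _ => by
      linear_combination - c₁ * θ * hδ2 i j
  rw [x1] at e1
  rw [x4] at e4
  have f2 : a₀ / 2 / qf z * (∑ i, ∑ j, z i * z j * X i j - ∑ i, ∑ j, z i * z j * Y i j) ≤
      a₀ / 2 * (-2 * c₁ + 2 * k) := by
    calc _ ≤ a₀ / 2 / qf z * (qf z * (-2 * c₁ + 2 * k)) :=
          mul_le_mul_of_nonneg_left e2' (by positivity)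
      _ = _ := by field_simp
  have f3 := mul_le_mul_of_nonneg_left e3 hθ
  have f5 := mul_le_mul_of_nonneg_left htrA hk
  have f6 := mul_le_mul_of_nonneg_left htrE hc₁
  have f7 : 0 ≤ a₀ / 2 / qf z * (2 * k) * qf z := by positivity
  have f8 : 0 ≤ 2 * k * θ * N := by positivity
  linarith

set_option maxHeartbeats 1000000 in
lemma spatial_holder {N : ℕ} {a : Fin N → Fin N → (Fin N → ℝ) → ℝ → ℝ}
    {b : Fin N → (Fin N → ℝ) → ℝ → ℝ} {c : (Fin N → ℝ) → ℝ → ℝ}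
    {u : (Fin N → ℝ) → ℝ → ℝ} {a₀ B K F : ℝ} (ha₀ : 0 < a₀) (hB : 0 ≤ B)
    (hsym : ∀ i j x t, a i j x t = a j i x t)
    (hell : ∀ (x : Fin N → ℝ) (t : ℝ) (ξ : Fin N → ℝ),
      a₀ * qf ξ ≤ ∑ i, ∑ j, a i j x t * ξ i * ξ j)
    (hA : ∀ i j x t, |a i j x t| ≤ B) (hb : ∀ i x t, |b i x t| ≤ B)
    (huc : ∀ i j, UC2 (a i j)) (hK : 0 ≤ K) (hu : ∀ x t, |u x t| ≤ K) (hF0 : 0 ≤ F)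
    (hF : ∀ x t, |c x t * u x t| ≤ F)
    (hsol : IsSol a b c (fun _ _ => 0) u) :
    ∃ L > 0, ∀ x y t, u x t - u y t ≤ L * qf (x - y) ^ (1 / 4 : ℝ) := by
  obtain ⟨⟨hcont, hdt, hdx⟩, heq⟩ := hsol
  set θ := a₀ / (6 * (N + 1)) with hθ
  have hN1 : (0 : ℝ) < N + 1 := by positivity
  have hθ0 : 0 < θ := by positivity
  have hθeq : 6 * (N + 1) * θ = a₀ := by rw [hθ]; field_simp
  have hNθ : 0 ≤ N * θ := by positivity
  -- modulus of continuity of `a`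
  obtain ⟨ρ, hρ0, hρ⟩ : ∃ ρ > 0, ∀ i j x y t, dist x y < ρ → |a i j y t - a i j x t| < θ / (N + 1) := by
    have h1 : ∀ i j, ∃ ρ > 0, ∀ x y t, dist x y < ρ → |a i j y t - a i j x t| < θ / (N + 1) := by
      intro i j
      obtain ⟨ρ, h0, h⟩ := Metric.uniformContinuous_iff.mp (huc i j) (θ / (N + 1)) (by positivity)
      refine ⟨ρ, h0, fun x y t hxy => ?_⟩
      have := @h (y, t) (x, t) (by simpa [Prod.dist_eq, dist_comm, h0] using hxy)
      simpa [Real.dist_eq] using this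
    choose ρ h0 h using h1
    rcases isEmpty_or_nonempty (Fin N) with hE | hE
    · exact ⟨1, one_pos, fun i => (hE.false i).elim⟩
    obtain ⟨i0⟩ := hE
    have hne : (Finset.univ : Finset (Fin N × Fin N)).Nonempty := ⟨(i0, i0), Finset.mem_univ _⟩
    refine ⟨Finset.univ.inf' hne fun q => ρ q.1 q.2, ?_, ?_⟩
    · rw [gt_iff_lt, Finset.lt_inf'_iff]
      exact fun q _ => h0 q.1 q.2
    · intro i j x y t hxy
      exact h i j x y t (hxy.trans_le
        (Finset.inf'_le (fun q : Fin N × Fin N => ρ q.1 q.2) (Finset.mem_univ (i, j))))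
  set r := min 1 (min (ρ / 2) (a₀ / (8 * (N * B + 1)))) with hr
  have hr0 : 0 < r := by positivity
  have hr1 : r ≤ 1 := min_le_left _ _
  have hrρ : r < ρ := by
    have : r ≤ ρ / 2 := (min_le_right _ _).trans (min_le_left _ _)
    linarith
  have hrB : N * B * r ≤ a₀ / 8 := by
    have h1 : r ≤ a₀ / (8 * (N * B + 1)) := (min_le_right _ _).trans (min_le_right _ _)
    have h2 : 0 < 8 * (N * B + 1) := by positivity
    rw [le_div_iff₀ h2] at h1
    linarith
  set L := 2 * K / r + 8 * (2 * F + 2) / a₀ with hL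
  have hL0 : 0 < L := by positivity
  have hLr : 2 * K ≤ L * r := by
    have : 0 ≤ 8 * (2 * F + 2) / a₀ * r := by positivity
    rw [hL, add_mul, div_mul_cancel₀ _ hr0.ne']; linarith
  have hLa : 8 * (2 * F + 2) ≤ L * a₀ := by
    have : 0 ≤ 2 * K / r * a₀ := by positivity
    rw [hL, add_mul, div_mul_cancel₀ _ ha₀.ne']; linarith
  refine ⟨L, hL0, ?_⟩
  by_contra hcon
  push Not at hcon
  obtain ⟨x₀, y₀, t₀, hviol⟩ := hcon
  set K' := 2 * K + 1 with hK'
  set C := 2 * (N * B + a₀ / 2 + N * θ) + 2 * (N * B * K') + 2 * K' with hC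
  have hC0 : 0 ≤ C := by positivity
  obtain ⟨μ, hμ0, hμ1, hμC, hμv⟩ : ∃ μ : ℝ, 0 < μ ∧ μ < 1 ∧ μ * C < 1 ∧
      μ ^ 2 * (qf x₀ + t₀ ^ 2) < u x₀ t₀ - u y₀ t₀ - L * qf (x₀ - y₀) ^ (1 / 4 : ℝ) := by
    have h1 : ∀ᶠ μ in 𝓝 (0 : ℝ), μ < 1 := gt_mem_nhds one_pos
    have h2 : ∀ᶠ μ in 𝓝 (0 : ℝ), μ * C < 1 :=
      (show ContinuousAt (fun μ : ℝ => μ * C) 0 by fun_prop).eventually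
        (gt_mem_nhds (by simp))
    have h3 : ∀ᶠ μ in 𝓝 (0 : ℝ), μ ^ 2 * (qf x₀ + t₀ ^ 2) <
        u x₀ t₀ - u y₀ t₀ - L * qf (x₀ - y₀) ^ (1 / 4 : ℝ) :=
      (show ContinuousAt (fun μ : ℝ => μ ^ 2 * (qf x₀ + t₀ ^ 2)) 0 by fun_prop).eventually
        (gt_mem_nhds (by simpa using hviol))
    have h4 := ((h1.and (h2.and h3)).filter_mono (nhdsWithin_le_nhds (s := Set.Ioi 0))).and
      self_mem_nhdsWithin
    obtain ⟨μ, ⟨g1, g2, g3⟩, g4⟩ := h4.exists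
    exact ⟨μ, g4, g1, g2, g3⟩
  set f : (Fin N → ℝ) × (Fin N → ℝ) × ℝ → ℝ := fun p =>
    u p.1 p.2.2 - u p.2.1 p.2.2 - L * qf (p.1 - p.2.1) ^ (1 / 4 : ℝ)
      - μ ^ 2 * (qf p.1 + p.2.2 ^ 2) with hf
  have hfc : Continuous f := by
    have hq := @qf_cont N
    have h1 : Continuous fun p : (Fin N → ℝ) × (Fin N → ℝ) × ℝ => u p.1 p.2.2 :=
      hcont.comp (g := fun q : (Fin N → ℝ) × ℝ => u q.1 q.2)
        (f := fun p : (Fin N → ℝ) × (Fin N → ℝ) × ℝ => (p.1, p.2.2)) (by fun_prop)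
    have h2 : Continuous fun p : (Fin N → ℝ) × (Fin N → ℝ) × ℝ => u p.2.1 p.2.2 :=
      hcont.comp (g := fun q : (Fin N → ℝ) × ℝ => u q.1 q.2)
        (f := fun p : (Fin N → ℝ) × (Fin N → ℝ) × ℝ => (p.2.1, p.2.2)) (by fun_prop)
    have h3 : Continuous fun p : (Fin N → ℝ) × (Fin N → ℝ) × ℝ =>
        qf (p.1 - p.2.1) ^ (1 / 4 : ℝ) :=
      Continuous.rpow_const (by fun_prop) fun _ => Or.inr (by norm_num)
    simp only [hf]
    fun_prop
  have hbd : ∀ x y t, 0 < f (x, y, t) → (∀ i, μ * |x i| ≤ K') ∧ μ * |t| ≤ K' ∧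
      qf (x - y) ≤ r ^ 2 := by
    intro x y t h
    simp only [hf] at h
    have h1 := abs_le.mp (hu x t)
    have h2 := abs_le.mp (hu y t)
    have hq4 : 0 ≤ qf (x - y) ^ (1 / 4 : ℝ) := Real.rpow_nonneg (qf_nonneg _) _
    have h3 : 0 ≤ L * qf (x - y) ^ (1 / 4 : ℝ) := by positivity
    have h4 : 0 ≤ μ ^ 2 * qf x := mul_nonneg (sq_nonneg _) (qf_nonneg _)
    have h5 : 0 ≤ μ ^ 2 * t ^ 2 := by positivity
    have aux : ∀ w : ℝ, μ ^ 2 * w ^ 2 ≤ 2 * K → μ * |w| ≤ K' := by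
      intro w hw
      have hn : 0 ≤ μ * |w| := by positivity
      have : (μ * |w|) ^ 2 ≤ 2 * K := by rw [mul_pow, sq_abs]; exact hw
      rw [hK']
      nlinarith
    refine ⟨fun i => aux _ ?_, aux _ (by linarith), ?_⟩
    · have := mul_le_mul_of_nonneg_left (sq_le_qf x i) (sq_nonneg μ)
      linarith
    · have h6 : L * qf (x - y) ^ (1 / 4 : ℝ) ≤ L * r := by linarith
      have h7 : qf (x - y) ^ (1 / 4 : ℝ) ≤ r := le_of_mul_le_mul_left h6 hL0
      have h8 : (qf (x - y) ^ (1 / 4 : ℝ)) ^ 4 = qf (x - y) := by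
        rw [← Real.rpow_natCast, ← Real.rpow_mul (qf_nonneg _)]; norm_num
      rw [← h8]
      calc (qf (x - y) ^ (1 / 4 : ℝ)) ^ 4 ≤ r ^ 4 := pow_le_pow_left₀ hq4 h7 4
        _ ≤ r ^ 2 := pow_le_pow_of_le_one hr0.le hr1 (by norm_num)
  have hp0 : 0 < f (x₀, y₀, t₀) := by simp only [hf]; linarith
  obtain ⟨⟨x, y, t⟩, hmax⟩ := hfc.exists_forall_ge' (x₀ := (x₀, y₀, t₀)) (by
    have hcb : IsCompact (Metric.closedBall (0 : (Fin N → ℝ) × (Fin N → ℝ) × ℝ) (K' / μ + 1)) :=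
      isCompact_closedBall _ _
    filter_upwards [hcb.compl_mem_cocompact] with p hp
    by_contra hlt
    push Not at hlt
    apply hp
    obtain ⟨x, y, t⟩ := p
    obtain ⟨g1, g2, g3⟩ := hbd x y t (hp0.trans hlt)
    have hR : 0 ≤ K' / μ + 1 := by positivity
    have g1' : ∀ i, |x i| ≤ K' / μ := fun i => by
      rw [le_div_iff₀ hμ0]; linarith [g1 i]
    have g4 := abs_le_of_qf hr0.le g3
    rw [mem_closedBall_zero_iff, Prod.norm_def, Prod.norm_def]
    refine max_le ?_ (max_le ?_ ?_)
    · rw [pi_norm_le_iff_of_nonneg hR]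
      exact fun i => (g1' i).trans (by linarith)
    · rw [pi_norm_le_iff_of_nonneg hR]
      intro i
      have h1 := g1' i
      have h2 := g4 i
      simp only [Pi.sub_apply] at h2
      have h3 : |y i| ≤ |x i| + |x i - y i| := by
        have := abs_sub (x i) (x i - y i)
        simpa using this
      rw [Real.norm_eq_abs]
      linarith
    · have : |t| ≤ K' / μ := by rw [le_div_iff₀ hμ0]; linarith
      simp only [Real.norm_eq_abs]; linarith)
  have hpos : 0 < f (x, y, t) := hp0.trans_le (hmax _)
  obtain ⟨hbx, hbt, hbz⟩ := hbd x y t hpos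
  have hz : 0 < qf (x - y) := by
    apply qf_pos
    intro h0
    have hxy : x = y := sub_eq_zero.mp h0
    subst hxy
    simp only [hf] at hpos
    have h1 : 0 ≤ L * qf (x - x) ^ (1 / 4 : ℝ) :=
      mul_nonneg hL0.le (Real.rpow_nonneg (qf_nonneg _) _)
    have h2 : 0 ≤ μ ^ 2 * (qf x + t ^ 2) :=
      mul_nonneg (sq_nonneg _) (add_nonneg (qf_nonneg _) (sq_nonneg _))
    linarith
  -- space information
  obtain ⟨hgx, hgy, hH⟩ := doubling_space (hdx t) x y L (μ ^ 2) hz (by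
    intro x' y'
    have := hmax (x', y', t)
    simp only [hf] at this
    linarith)
  set z := x - y with hzdef
  set c₁ := L / 2 * qf z ^ (-3 / 4 : ℝ) with hc₁
  have hz1 : 1 ≤ qf z ^ (-3 / 4 : ℝ) :=
    Real.one_le_rpow_of_pos_of_le_one_of_nonpos hz (hbz.trans (pow_le_one₀ hr0.le hr1))
      (by norm_num)
  have hc₁L : L / 2 ≤ c₁ := le_mul_of_one_le_right (by positivity) hz1
  have hc₁0 : 0 < c₁ := by linarith
  -- time information
  have htime : deriv (fun s => u x s) t - deriv (fun s => u y s) t = 2 * μ ^ 2 * t := by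
    have hd : HasDerivAt (fun s => f (x, y, s))
        (deriv (fun s => u x s) t - deriv (fun s => u y s) t - 2 * μ ^ 2 * t) t := by
      have h1 := (hdt x t).hasDerivAt
      have h2 := (hdt y t).hasDerivAt
      have h3 := ((((hasDerivAt_id t).pow 2).const_add (qf x)).const_mul (μ ^ 2))
      refine (((h1.sub h2).sub_const (L * qf (x - y) ^ (1 / 4 : ℝ))).sub h3).congr_deriv ?_
      simp; ring
    have hloc : IsLocalMax (fun s => f (x, y, s)) t :=
      Eventually.of_forall fun s => hmax (x, y, s)
    have := hloc.hasDerivAt_eq_zero hd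
    linarith
  have hdist : dist x y < ρ := by
    rw [dist_eq_norm]
    refine lt_of_le_of_lt ?_ hrρ
    rw [pi_norm_le_iff_of_nonneg hr0.le]
    exact fun i => abs_le_of_qf hr0.le hbz i
  have htr := doubling_trace (A := fun i j => a i j x t) (A' := fun i j => a i j y t)
    (X := fun i j => pd2 i j (fun y => u y t) x) (Y := fun i j => pd2 i j (fun y => u y t) y)
    (z := z) (a₀ := a₀) (B := B) (θ := θ) (c₁ := c₁) (k := μ ^ 2)
    hz hc₁0.le (sq_nonneg _) hθ0.le (by linarith) (fun i j => hsym i j x t)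
    (fun i j => hsym i j y t) (hell x t) (fun i j => hA i j x t)
    (fun i j => by
      have := (hρ i j x y t hdist).le
      rw [le_div_iff₀ hN1] at this
      have h2 := abs_nonneg (a i j y t - a i j x t)
      linarith) hH
  -- first-order terms
  have hfirst : ∑ i, b i x t * pd i (fun y => u y t) x - ∑ i, b i y t * pd i (fun y => u y t) y
      ≤ 2 * (N * B * r) * c₁ + 2 * μ * (N * B * K') := by
    rw [← Finset.sum_sub_distrib]
    calc _ ≤ ∑ _i : Fin N, (2 * (B * r) * c₁ + 2 * μ * (B * K')) := by
          refine Finset.sum_le_sum fun i _ => ?_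
          rw [hgx i, hgy i]
          have hzi := abs_le_of_qf hr0.le hbz i
          have g1 : (b i x t - b i y t) * z i ≤ 2 * B * r := by
            refine (le_abs_self _).trans ?_
            rw [abs_mul]
            refine mul_le_mul ?_ hzi (abs_nonneg _) (by positivity)
            have := abs_sub (b i x t) (b i y t)
            linarith [hb i x t, hb i y t]
          have g2 : b i x t * (μ * x i) ≤ B * K' := by
            refine (le_abs_self _).trans ?_
            rw [abs_mul]
            refine mul_le_mul (hb i x t) ?_ (abs_nonneg _) hB
            rw [abs_mul, abs_of_pos hμ0]; exact hbx i
          have g3 := mul_le_mul_of_nonneg_left g1 hc₁0.le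
          have g4 := mul_le_mul_of_nonneg_left g2 hμ0.le
          linarith
      _ = _ := by simp; ring
  have hqx := heq x t
  have hqy := heq y t
  simp only [parOp] at hqx hqy
  have hcx := abs_le.mp (hF x t)
  have hcy := abs_le.mp (hF y t)
  have ht1 : - (μ * K') ≤ μ ^ 2 * t := by
    have h1 : -K' ≤ μ * t := by
      have h2 : |μ * t| ≤ K' := by rw [abs_mul, abs_of_pos hμ0]; exact hbt
      exact (abs_le.mp h2).1
    have := mul_le_mul_of_nonneg_left h1 hμ0.le
    linarith
  have hμ2 : μ ^ 2 * (N * B + a₀ / 2 + N * θ) ≤ μ * (N * B + a₀ / 2 + N * θ) := by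
    refine mul_le_mul_of_nonneg_right ?_ (by positivity)
    nlinarith
  have k1 : c₁ * (-a₀ + 3 * N * θ) ≤ c₁ * (-a₀ / 2) :=
    mul_le_mul_of_nonneg_left (by linarith) hc₁0.le
  have k2 : (N * B * r) * c₁ ≤ a₀ / 8 * c₁ := mul_le_mul_of_nonneg_right hrB hc₁0.le
  have k3 : L / 2 * a₀ ≤ c₁ * a₀ := mul_le_mul_of_nonneg_right hc₁L ha₀.le
  rw [hC] at hμC
  linarith

/-! ### Operations on solutions -/

lemma pd_comp_add {N : ℕ} (i : Fin N) (φ : (Fin N → ℝ) → ℝ) (k x : Fin N → ℝ) :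
    pd i (fun y => φ (y + k)) x = pd i φ (x + k) := by
  simp only [pd]
  rw [fderiv_comp_add_right]

lemma pd2_comp_add {N : ℕ} (i j : Fin N) (φ : (Fin N → ℝ) → ℝ) (k x : Fin N → ℝ) :
    pd2 i j (fun y => φ (y + k)) x = pd2 i j φ (x + k) := by
  simp only [pd2, pd_comp_add]

lemma pd_sub {N : ℕ} (i : Fin N) {φ ψ : (Fin N → ℝ) → ℝ} {x : Fin N → ℝ}
    (h1 : DifferentiableAt ℝ φ x) (h2 : DifferentiableAt ℝ ψ x) :
    pd i (fun y => φ y - ψ y) x = pd i φ x - pd i ψ x := by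
  simp only [pd]
  rw [fderiv_fun_sub h1 h2]; simp

lemma pd2_sub {N : ℕ} (i j : Fin N) {φ ψ : (Fin N → ℝ) → ℝ} (x : Fin N → ℝ)
    (h1 : ContDiff ℝ 2 φ) (h2 : ContDiff ℝ 2 ψ) :
    pd2 i j (fun y => φ y - ψ y) x = pd2 i j φ x - pd2 i j ψ x := by
  simp only [pd2]
  have : (fun y => pd j (fun y => φ y - ψ y) y) = fun y => pd j φ y - pd j ψ y := by
    funext y
    exact pd_sub j (h1.differentiable (by norm_num) y) (h2.differentiable (by norm_num) y)
  rw [this]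
  exact pd_sub i (pd_diff h1 j x) (pd_diff h2 j x)

section ops

variable {N : ℕ} {a : Fin N → Fin N → (Fin N → ℝ) → ℝ → ℝ}
    {b : Fin N → (Fin N → ℝ) → ℝ → ℝ} {c : (Fin N → ℝ) → ℝ → ℝ}

lemma sol_sub {u v : (Fin N → ℝ) → ℝ → ℝ} (hu : IsSol a b c (fun _ _ => 0) u)
    (hv : IsSol a b c (fun _ _ => 0) v) :
    IsSol a b c (fun _ _ => 0) (fun x t => u x t - v x t) := by
  obtain ⟨⟨h1, h2, h3⟩, h4⟩ := hu
  obtain ⟨⟨g1, g2, g3⟩, g4⟩ := hv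
  refine ⟨⟨h1.sub g1, fun x => (h2 x).sub (g2 x), fun t => (h3 t).sub (g3 t)⟩, fun x t => ?_⟩
  have e1 := h4 x t
  have e2 := g4 x t
  simp only [parOp] at e1 e2 ⊢
  rw [deriv_fun_sub (h2 x t) (g2 x t)]
  simp only [pd2_sub _ _ x (h3 t) (g3 t), pd_sub _ ((h3 t).differentiable (by norm_num) x)
    ((g3 t).differentiable (by norm_num) x), mul_sub, Finset.sum_sub_distrib]
  linarith

lemma pd_const {N : ℕ} (i : Fin N) (k : ℝ) (x : Fin N → ℝ) : pd i (fun _ => k) x = 0 := by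
  simp [pd]

lemma parOp_const (k : ℝ) (x : Fin N → ℝ) (t : ℝ) :
    parOp a b c (fun _ _ => k) x t = - (c x t * k) := by
  simp [parOp, pd2, pd_const]

lemma sol_const {k : ℝ} (h : ∀ x t, c x t * k = 0) :
    IsSol a b c (fun _ _ => 0) (fun _ _ => k) := by
  refine ⟨⟨continuous_const, fun x => differentiable_const _, fun t => contDiff_const⟩, ?_⟩
  intro x t
  rw [parOp_const, h, neg_zero]

lemma sol_neg {u : (Fin N → ℝ) → ℝ → ℝ} (hu : IsSol a b c (fun _ _ => 0) u) :
    IsSol a b c (fun _ _ => 0) (fun x t => - u x t) := by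
  have := sol_sub (sol_const (a := a) (b := b) (c := c) (k := 0) (by simp)) hu
  simpa using this

lemma sol_shift {u : (Fin N → ℝ) → ℝ → ℝ} (hu : IsSol a b c (fun _ _ => 0) u)
    {k : Fin N → ℝ} {m : ℝ} (ha : ∀ i j x t, a i j (x + k) (t + m) = a i j x t)
    (hb : ∀ i x t, b i (x + k) (t + m) = b i x t) (hc : ∀ x t, c (x + k) (t + m) = c x t) :
    IsSol a b c (fun _ _ => 0) (fun x t => u (x + k) (t + m)) := by
  obtain ⟨⟨h1, h2, h3⟩, h4⟩ := hu
  refine ⟨⟨?_, fun x => ?_, fun t => ?_⟩, fun x t => ?_⟩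
  · exact h1.comp (g := fun q : (Fin N → ℝ) × ℝ => u q.1 q.2)
      (f := fun p : (Fin N → ℝ) × ℝ => (p.1 + k, p.2 + m)) (by fun_prop)
  · exact (h2 (x + k)).comp (differentiable_id.add_const m)
  · exact (h3 (t + m)).comp (contDiff_id.add contDiff_const)
  · have e := h4 (x + k) (t + m)
    simp only [parOp, ha, hb, hc] at e ⊢
    rw [deriv_comp_add_const (fun s => u (x + k) s)]
    simp only [pd2_comp_add _ _ (fun y => u y (t + m)), pd_comp_add _ (fun y => u y (t + m))]
    exact e

end ops

/-! ### Propagation of near-maxima -/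

/-- Standing assumptions in the form used below. -/
structure Good {N : ℕ} (a : Fin N → Fin N → (Fin N → ℝ) → ℝ → ℝ)
    (b : Fin N → (Fin N → ℝ) → ℝ → ℝ) (c : (Fin N → ℝ) → ℝ → ℝ) (a₀ B : ℝ) : Prop where
  ha₀ : 0 < a₀
  hB : 0 ≤ B
  hsym : ∀ i j x t, a i j x t = a j i x t
  hell : ∀ (x : Fin N → ℝ) (t : ℝ) (ξ : Fin N → ℝ),
      a₀ * qf ξ ≤ ∑ i, ∑ j, a i j x t * ξ i * ξ j
  hA : ∀ i j x t, |a i j x t| ≤ B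
  hb : ∀ i x t, |b i x t| ≤ B
  hcB : ∀ x t, |c x t| ≤ B
  hc : ∀ x t, c x t ≤ 0
  huc : ∀ i j, UC2 (a i j)

lemma exists_bound_fin {ι α : Type*} [Finite ι] (f : ι → α → ℝ) (h : ∀ i, ∃ M, ∀ x, |f i x| ≤ M) :
    ∃ M, 0 ≤ M ∧ ∀ i x, |f i x| ≤ M := by
  have := Fintype.ofFinite ι
  choose M hM using h
  refine ⟨∑ i, |M i|, Finset.sum_nonneg fun i _ => abs_nonneg _, fun i x => ?_⟩
  exact (hM i x).trans ((le_abs_self _).trans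
    (Finset.single_le_sum (f := fun i => |M i|) (fun i _ => abs_nonneg _) (Finset.mem_univ i)))

section main

variable {N : ℕ} {a : Fin N → Fin N → (Fin N → ℝ) → ℝ → ℝ}
    {b : Fin N → (Fin N → ℝ) → ℝ → ℝ} {c : (Fin N → ℝ) → ℝ → ℝ} {a₀ B : ℝ}

lemma good_of_std (h : StdCoeffs a b c) (hc : ∀ x t, c x t ≤ 0) : ∃ a₀ B, Good a b c a₀ B := by
  obtain ⟨h1, h2, h3, h4, ⟨M3, h5⟩, h6, h7, a₀, a₁, h8, h9, h10⟩ := h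
  obtain ⟨M1, p1, q1⟩ := exists_bound_fin
    (fun (i : Fin N × Fin N) (p : (Fin N → ℝ) × ℝ) => a i.1 i.2 p.1 p.2)
    (fun i => (h1 i.1 i.2).imp fun M hM p => hM p.1 p.2)
  obtain ⟨M2, p2, q2⟩ := exists_bound_fin
    (fun (i : Fin N) (p : (Fin N → ℝ) × ℝ) => b i p.1 p.2)
    (fun i => (h3 i).imp fun M hM p => hM p.1 p.2)
  have p3 : 0 ≤ M3 := (abs_nonneg _).trans (h5 0 0)
  exact ⟨a₀, M1 + M2 + M3, h8, by positivity, h7, fun x t ξ => (h10 x t ξ).1,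
    fun i j x t => (q1 (i, j) (x, t)).trans (by linarith),
    fun i x t => (q2 i (x, t)).trans (by linarith),
    fun x t => (h5 x t).trans (by linarith), hc, h2⟩

lemma Good.holder (G : Good a b c a₀ B) {u : (Fin N → ℝ) → ℝ → ℝ}
    (hsol : IsSol a b c (fun _ _ => 0) u) (hbd : Bdd2 u) :
    ∃ L > 0, ∀ x y t, u x t - u y t ≤ L * qf (x - y) ^ (1 / 4 : ℝ) := by
  obtain ⟨K, hK⟩ := hbd
  have hK0 : 0 ≤ K := (abs_nonneg _).trans (hK 0 0)
  refine spatial_holder (F := B * K) G.ha₀ G.hB G.hsym G.hell G.hA G.hb G.huc hK0 hK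
    (mul_nonneg G.hB hK0) (fun x t => ?_) hsol
  rw [abs_mul]
  exact mul_le_mul (G.hcB x t) (hK x t) (abs_nonneg _) G.hB

lemma Good.propagate (G : Good a b c a₀ B) {v : (Fin N → ℝ) → ℝ → ℝ}
    (hsol : IsSol a b c (fun _ _ => 0) v) (hbd : Bdd2 v)
    {M δ D T₀ T₁ : ℝ} (hM : ∀ x t, v x t ≤ M) (hM0 : 0 < M) (hδ : 0 < δ) (hD : 0 ≤ D)
    (hT₀ : 0 < T₀) :
    ∃ η > 0, ∀ x₀ t₀ x₁ T, T₀ ≤ T → T ≤ T₁ → (∀ i, |x₀ i - x₁ i| ≤ D) →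
      M - η < v x₀ t₀ → M - δ < v x₁ (t₀ - T) := by
  obtain ⟨L, hL0, hL⟩ := G.holder hsol hbd
  set s := δ / (2 * L) with hs
  have hs0 : 0 < s := by positivity
  obtain ⟨η, hη, h⟩ := barrier (δ := min (δ / 2) M) (r := s ^ 2) (T₁ := T₁) G.ha₀ G.hB G.hsym
    G.hell G.hA G.hb G.hc hsol hM (by positivity) (min_le_right _ _) (by positivity) hD hT₀
  refine ⟨η, hη, fun x₀ t₀ x₁ T h1 h2 h3 h4 => ?_⟩
  by_contra h5
  push Not at h5
  have h6 := h x₀ t₀ x₁ T h1 h2 h3 (fun x hx => by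
    have e1 := hL x x₁ (t₀ - T)
    have e2 : qf (x - x₁) ^ (1 / 4 : ℝ) ≤ s := by
      calc qf (x - x₁) ^ (1 / 4 : ℝ) ≤ ((s ^ 2) ^ 2) ^ (1 / 4 : ℝ) :=
            Real.rpow_le_rpow (qf_nonneg _) hx (by norm_num)
        _ = s := by
            rw [← pow_mul, ← Real.rpow_natCast, ← Real.rpow_mul hs0.le]; norm_num
    have e3 := mul_le_mul_of_nonneg_left e2 hL0.le
    have e4 : L * s = δ / 2 := by rw [hs]; field_simp
    have e5 : min (δ / 2) M ≤ δ / 2 := min_le_left _ _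
    linarith)
  linarith

/-- A bounded solution does not increase along a period with non-positive time component. -/
lemma Good.shift_le (G : Good a b c a₀ B) {u : (Fin N → ℝ) → ℝ → ℝ}
    (hsol : IsSol a b c (fun _ _ => 0) u) (hbd : Bdd2 u)
    {k : Fin N → ℝ} {m : ℝ} (hm : m ≤ 0) (ha : ∀ i j x t, a i j (x + k) (t + m) = a i j x t)
    (hb : ∀ i x t, b i (x + k) (t + m) = b i x t) (hc : ∀ x t, c (x + k) (t + m) = c x t)
    (x : Fin N → ℝ) (t : ℝ) : u (x + k) (t + m) ≤ u x t := by
  by_contra hcon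
  push Not at hcon
  set v : (Fin N → ℝ) → ℝ → ℝ := fun x t => u (x + k) (t + m) - u x t with hv
  have hvsol : IsSol a b c (fun _ _ => 0) v := sol_sub (sol_shift hsol ha hb hc) hsol
  obtain ⟨K, hK⟩ := hbd
  have hK0 : 0 ≤ K := (abs_nonneg _).trans (hK 0 0)
  have hvb : ∀ x t, |v x t| ≤ 2 * K := fun x t => by
    have := abs_sub (u (x + k) (t + m)) (u x t)
    linarith [hK (x + k) (t + m), hK x t]
  set R := Set.range fun p : (Fin N → ℝ) × ℝ => v p.1 p.2 with hR
  have hRb : BddAbove R := ⟨2 * K, by rintro _ ⟨p, rfl⟩; exact (abs_le.mp (hvb _ _)).2⟩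
  have hRn : R.Nonempty := ⟨_, (x, t), rfl⟩
  set M := sSup R with hMdef
  have hM : ∀ x t, v x t ≤ M := fun x t => le_csSup hRb ⟨(x, t), rfl⟩
  have hM0 : 0 < M := lt_of_lt_of_le (by simp only [hv]; linarith) (hM x t)
  obtain ⟨n, hn⟩ := exists_nat_gt (2 * K / (M / 2))
  rw [div_lt_iff₀ (by positivity)] at hn
  obtain ⟨η, hη, hprop⟩ := G.propagate hvsol ⟨_, hvb⟩ (δ := M / 2) (D := n * ‖k‖) (T₀ := 1)
    (T₁ := 1 - n * m) hM hM0 (by positivity) (by positivity) one_pos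
  obtain ⟨_, ⟨⟨x₀, t₀⟩, rfl⟩, hx₀⟩ := exists_lt_of_lt_csSup hRn (show M - η < sSup R by linarith)
  have hi : ∀ i ∈ Finset.range n, M / 2 ≤
      u (x₀ + ((i + 1 : ℕ) : ℝ) • k) (t₀ - 1 + ((i + 1 : ℕ) : ℝ) * m) -
        u (x₀ + ((i : ℕ) : ℝ) • k) (t₀ - 1 + ((i : ℕ) : ℝ) * m) := by
    intro i hi
    have hin : (i : ℝ) ≤ n := by exact_mod_cast (Finset.mem_range.mp hi).le
    have hi0 : (0 : ℝ) ≤ i := by positivity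
    have := hprop x₀ t₀ (x₀ + (i : ℝ) • k) (1 - i * m) (by nlinarith) (by nlinarith)
      (fun j => by
        have : x₀ j - (x₀ + (i : ℝ) • k) j = - (i * k j) := by simp
        rw [this, abs_neg, abs_mul, abs_of_nonneg hi0]
        exact mul_le_mul hin (norm_le_pi_norm k j) (abs_nonneg _) (by positivity)) hx₀
    simp only [hv] at this
    rw [show x₀ + (i : ℝ) • k + k = x₀ + ((i + 1 : ℕ) : ℝ) • k by push_cast; module,
      show t₀ - (1 - i * m) + m = t₀ - 1 + ((i + 1 : ℕ) : ℝ) * m by push_cast; ring,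
      show t₀ - (1 - i * m) = t₀ - 1 + i * m by ring] at this
    linarith
  have hsum := Finset.sum_le_sum hi
  rw [Finset.sum_range_sub (fun i : ℕ => u (x₀ + (i : ℝ) • k) (t₀ - 1 + (i : ℝ) * m))] at hsum
  simp only [Finset.sum_const, Finset.card_range, nsmul_eq_mul, Nat.cast_zero, zero_smul, zero_mul, add_zero] at hsum
  have h1 := (abs_le.mp (hK (x₀ + (n : ℝ) • k) (t₀ - 1 + (n : ℝ) * m))).2
  have h2 := (abs_le.mp (hK x₀ (t₀ - 1))).1
  linarith

lemma Good.shift_eq (G : Good a b c a₀ B) {u : (Fin N → ℝ) → ℝ → ℝ}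
    (hsol : IsSol a b c (fun _ _ => 0) u) (hbd : Bdd2 u)
    {k : Fin N → ℝ} {m : ℝ} (hm : m ≤ 0) (ha : ∀ i j x t, a i j (x + k) (t + m) = a i j x t)
    (hb : ∀ i x t, b i (x + k) (t + m) = b i x t) (hc : ∀ x t, c (x + k) (t + m) = c x t)
    (x : Fin N → ℝ) (t : ℝ) : u (x + k) (t + m) = u x t := by
  refine le_antisymm (G.shift_le hsol hbd hm ha hb hc x t) ?_
  have := G.shift_le (sol_neg hsol) (hbd.imp fun K hK x t => by simpa using hK x t) hm ha hb hc x t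
  linarith

lemma lattice_point {l w : ℝ} (hl : 0 < l) : ∃ n : ℤ, 0 ≤ w + n * l ∧ w + n * l ≤ l := by
  refine ⟨-⌊w / l⌋, ?_, ?_⟩
  · have := Int.floor_le (w / l)
    rw [le_div_iff₀ hl] at this
    push_cast; linarith
  · have := (Int.lt_floor_add_one (w / l)).le
    rw [div_le_iff₀ hl] at this
    push_cast; linarith

/-- A space-time periodic bounded solution with positive supremum is constant. -/
lemma Good.periodic_const (G : Good a b c a₀ B) {u : (Fin N → ℝ) → ℝ → ℝ}
    (hsol : IsSol a b c (fun _ _ => 0) u) (hbd : Bdd2 u) {l : Fin N → ℝ} {τ : ℝ}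
    (hl : ∀ i, 0 < l i) (hτ : 0 < τ) (hper : PerAll l τ u)
    {x' : Fin N → ℝ} {t' : ℝ} (hpos : 0 < u x' t') : ∃ M, 0 < M ∧ ∀ x t, u x t = M := by
  obtain ⟨K, hK⟩ := hbd
  set R := Set.range fun p : (Fin N → ℝ) × ℝ => u p.1 p.2 with hR
  have hRb : BddAbove R := ⟨K, by rintro _ ⟨p, rfl⟩; exact (abs_le.mp (hK _ _)).2⟩
  have hRn : R.Nonempty := ⟨_, (x', t'), rfl⟩
  set M := sSup R with hMdef
  have hM : ∀ x t, u x t ≤ M := fun x t => le_csSup hRb ⟨(x, t), rfl⟩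
  have hM0 : 0 < M := hpos.trans_le (hM x' t')
  let S : AddSubgroup ((Fin N → ℝ) × ℝ) :=
    { carrier := {p | ∀ x t, u (x + p.1) (t + p.2) = u x t}
      zero_mem' := fun x t => by simp
      add_mem' := fun {p q} hp hq x t => by
        have h1 := hq (x + p.1) (t + p.2)
        rw [hp] at h1
        simpa [add_assoc] using h1
      neg_mem' := fun {p} hp x t => by
        have h1 := hp (x + -p.1) (t + -p.2)
        simpa using h1.symm }
  have hS : ∀ p, p ∈ S ↔ ∀ x t, u (x + p.1) (t + p.2) = u x t := fun p => Iff.rfl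
  have hlat : ∀ (n : Fin N → ℤ) (k : ℤ), ((fun i => (n i : ℝ) * l i), (k : ℝ) * τ) ∈ S := by
    intro n k
    have h1 : ∀ i, ((Pi.single i (l i) : Fin N → ℝ), (0 : ℝ)) ∈ S := fun i => by
      rw [hS]; intro x t; simpa using hper.1 i x t
    have h2 : ((0 : Fin N → ℝ), τ) ∈ S := by
      rw [hS]; intro x t; simpa using hper.2 x t
    have h3 : ∑ i, n i • ((Pi.single i (l i) : Fin N → ℝ), (0 : ℝ)) + k • ((0 : Fin N → ℝ), τ) ∈ S :=
      S.add_mem (S.sum_mem fun i _ => S.zsmul_mem (h1 i) _) (S.zsmul_mem h2 _)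
    convert h3 using 1
    ext j
    · simp [Prod.fst_sum, Finset.sum_apply, Pi.single_apply]
    · simp [Prod.snd_sum]
  refine ⟨M, hM0, fun x₁ t₁ => le_antisymm (hM _ _) ?_⟩
  refine le_of_forall_pos_lt_add fun δ hδ => ?_
  obtain ⟨η, hη, hprop⟩ := G.propagate hsol ⟨K, hK⟩ (δ := δ) (D := ∑ i, l i) (T₀ := τ)
    (T₁ := 2 * τ) hM hM0 hδ (Finset.sum_nonneg fun i _ => (hl i).le) hτ
  obtain ⟨_, ⟨⟨x₀, t₀⟩, rfl⟩, hx₀⟩ := exists_lt_of_lt_csSup hRn (show M - η < sSup R by linarith)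
  choose n hn1 hn2 using fun i => lattice_point (w := x₀ i - x₁ i) (hl i)
  obtain ⟨k, hk1, hk2⟩ := lattice_point (w := t₀ - t₁ - τ) hτ
  have hsh := (hS _).mp (hlat n k) x₀ t₀
  have := hprop (x₀ + fun i => (n i : ℝ) * l i) (t₀ + k * τ) x₁ (t₀ + k * τ - t₁)
    (by linarith) (by linarith) (fun i => by
      have e1 : (x₀ + fun i => (n i : ℝ) * l i) i - x₁ i = x₀ i - x₁ i + n i * l i := by
        simp; ring
      rw [e1, abs_of_nonneg (hn1 i)]
      exact (hn2 i).trans (Finset.single_le_sum (f := l) (fun i _ => (hl i).le)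
        (Finset.mem_univ i))) (by simp only at hsh hx₀ ⊢; rw [hsh]; exact hx₀)
  rw [sub_sub_cancel] at this
  linarith

end main

/-- **Corollary 1.2 (Liouville property for periodic operators).**  Let `u` be a
bounded solution of `P u = 0` on `ℝ^N × ℝ`, with `P` periodic (all coefficients with
the same period) and `c ≤ 0`.  Then either `c ≡ 0` and `u` is constant, or `c ≢ 0`
and `u ≡ 0`. -/
theorem liouville_periodic {N : ℕ}
    (a : Fin N → Fin N → (Fin N → ℝ) → ℝ → ℝ)
    (b : Fin N → (Fin N → ℝ) → ℝ → ℝ) (c : (Fin N → ℝ) → ℝ → ℝ)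
    (u : (Fin N → ℝ) → ℝ → ℝ) (l : Fin N → ℝ) (τ : ℝ)
    (hl : ∀ i, 0 < l i) (hτ : 0 < τ)
    (hstd : StdCoeffs a b c)
    (hc : ∀ x t, c x t ≤ 0)
    (haper : ∀ i j, PerAll l τ (a i j))
    (hbper : ∀ i, PerAll l τ (b i))
    (hcper : PerAll l τ c)
    (hsol : IsSol a b c (fun _ _ => 0) u)
    (hbdd : Bdd2 u) :
    ((∀ x t, c x t = 0) ∧ ∃ k : ℝ, ∀ x t, u x t = k) ∨
    ((¬ ∀ x t, c x t = 0) ∧ ∀ x t, u x t = 0) := by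
  obtain ⟨a₀, B, G⟩ := good_of_std hstd hc
  have hper : PerAll l τ u := by
    refine ⟨fun i x t => ?_, fun x t => ?_⟩
    · have := G.shift_eq hsol hbdd (k := Pi.single i (l i)) (m := 0) le_rfl
        (fun p q x t => by simpa using (haper p q).1 i x t)
        (fun p x t => by simpa using (hbper p).1 i x t)
        (fun x t => by simpa using hcper.1 i x t) x t
      simpa using this
    · have key : ∀ φ : (Fin N → ℝ) → ℝ → ℝ, PerAll l τ φ → ∀ x t, φ (x + 0) (t + -τ) = φ x t := by
        intro φ h x t
        have := h.2 x (t + -τ)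
        simpa using this.symm
      have := G.shift_eq hsol hbdd (k := 0) (m := -τ) (by linarith)
        (fun p q => key _ (haper p q)) (fun p => key _ (hbper p)) (key _ hcper) x (t + τ)
      simpa using this.symm
  by_cases hc0 : ∀ x t, c x t = 0
  · left
    refine ⟨hc0, ?_⟩
    have h1 : IsSol a b c (fun _ _ => 0) (fun x t => u x t - (u 0 0 - 1)) :=
      sol_sub hsol (sol_const (by simp [hc0]))
    obtain ⟨K, hK⟩ := hbdd
    obtain ⟨M, -, hM⟩ := G.periodic_const h1
      ⟨K + |u 0 0 - 1|, fun x t => (abs_sub _ _).trans (by linarith [hK x t])⟩ hl hτ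
      ⟨fun i x t => by simp only [hper.1], fun x t => by simp only [hper.2]⟩ (x' := 0) (t' := 0)
      (by norm_num)
    exact ⟨M + (u 0 0 - 1), fun x t => by linarith [hM x t]⟩
  · right
    refine ⟨hc0, ?_⟩
    have key : ∀ w : (Fin N → ℝ) → ℝ → ℝ, IsSol a b c (fun _ _ => 0) w → Bdd2 w →
        PerAll l τ w → ∀ x t, w x t ≤ 0 := by
      intro w hw hwb hwp x t
      by_contra hpos
      push Not at hpos
      obtain ⟨M, hM0, hM⟩ := G.periodic_const hw hwb hl hτ hwp hpos
      apply hc0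
      intro y s
      have hwM : w = fun _ _ => M := by funext y s; exact hM y s
      have h2 := hw.2 y s
      rw [hwM, parOp_const] at h2
      have h3 : c y s * M = 0 := by linarith
      exact (mul_eq_zero.mp h3).resolve_right hM0.ne'
    intro x t
    refine le_antisymm (key u hsol hbdd hper x t) ?_
    have := key (fun x t => - u x t) (sol_neg hsol)
      (hbdd.imp fun K hK x t => by simpa using hK x t)
      ⟨fun i x t => by simp only [hper.1], fun x t => by simp only [hper.2]⟩ x t
    linarith
end
end
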